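/- arXiv:1007.1791 — 7 statements merged into one kernel-verified Lean document; each statement's English description precedes it below -/
import Mathlib

section
/- For all integers n ≥ 1, m ≥ 0 and every integer i, let S(n,m,i) be the number of tuples (λ_0, λ_1, …, λ_{n−1}) of nonnegative integers satisfying λ_0 + λ_1 + ⋯ + λ_{n−1} = m and Σ_{j=0}^{n−1} j·λ_j ≡ i (mod n). Then (n+m)·S(n,m,i) = Σ_{d | gcd(n,m)} c_d(i) · binomial((n+m)/d, n/d), where the sum is over positive divisors d of gcd(n,m) (with gcd(n,0) = n). -/
open Finset

/-- The Ramanujan sum `c_d(i) = Σ_{e | gcd(d,i)} μ(d/e)·e` (sum of `i`-th powers of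
primitive `d`-th roots of unity). -/
def ramanujanSum (d : ℕ) (i : ℤ) : ℤ :=
  ∑ e ∈ (Nat.gcd d i.natAbs).divisors, ArithmeticFunction.moebius (d / e) * (e : ℤ)


open Polynomial in
theorem fej_sum_roots {d : ℕ} (hd : 0 < d) {ω : ℂ} (hω : IsPrimitiveRoot ω d)
    {M : Type*} [CommMonoid M] (f : ℂ → M) :
    ∏ z ∈ nthRootsFinset d (1 : ℂ), f z = ∏ j ∈ range d, f (ω ^ j) := by
  symm
  refine Finset.prod_bij (fun j _ => ω ^ j) ?_ ?_ ?_ ?_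
  · intro j _
    rw [Polynomial.mem_nthRootsFinset hd, ← pow_mul, mul_comm, pow_mul, hω.pow_eq_one, one_pow]
  · intro a ha b hb hab
    exact hω.pow_inj (mem_range.1 ha) (mem_range.1 hb) hab
  · intro z hz
    rw [Polynomial.mem_nthRootsFinset hd] at hz
    have : NeZero d := ⟨hd.ne'⟩
    obtain ⟨j, hj, h⟩ := hω.eq_pow_of_pow_eq_one hz
    exact ⟨j, mem_range.2 hj, h⟩
  · intros; rfl

theorem fej_orth {n : ℕ} (hn : 0 < n) (a : ℤ) :
    ∑ z ∈ Polynomial.nthRootsFinset n (1 : ℂ), z ^ a = if (n : ℤ) ∣ a then (n : ℂ) else 0 := by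
  have hω := Complex.isPrimitiveRoot_exp n hn.ne'
  set ω := Complex.exp (2 * Real.pi * Complex.I / n)
  have h1 := fej_sum_roots hn hω (fun z => Multiplicative.ofAdd (z ^ a))
  have h2 : ∑ z ∈ Polynomial.nthRootsFinset n (1 : ℂ), z ^ a = ∑ j ∈ range n, (ω ^ j) ^ a := h1
  have h3 : ∑ j ∈ range n, (ω ^ j) ^ a = ∑ j ∈ range n, (ω ^ a) ^ j := by
    refine Finset.sum_congr rfl fun j _ => ?_
    rw [← zpow_natCast, ← zpow_natCast, ← zpow_mul, ← zpow_mul, mul_comm]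
  rw [h2, h3]
  split_ifs with h
  · rw [(hω.zpow_eq_one_iff_dvd a).2 h]; simp
  · have hne : ω ^ a ≠ 1 := fun h' => h ((hω.zpow_eq_one_iff_dvd a).1 h')
    have := mul_geom_sum (ω ^ a) n
    have h4 : (ω ^ a) ^ n = 1 := by
      rw [← zpow_natCast, ← zpow_mul, mul_comm, zpow_mul, zpow_natCast, hω.pow_eq_one, one_zpow]
    rw [h4, sub_self] at this
    exact (mul_eq_zero.1 this).resolve_left (sub_ne_zero.2 hne)

theorem fej_roots_split (n : ℕ) (f : ℂ → ℂ) :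
    ∑ z ∈ Polynomial.nthRootsFinset n (1 : ℂ), f z
      = ∑ d ∈ n.divisors, ∑ z ∈ primitiveRoots d ℂ, f z := by
  rw [IsPrimitiveRoot.nthRoots_one_eq_biUnion_primitiveRoots, Finset.sum_biUnion]
  intro a _ b _ hab
  exact IsPrimitiveRoot.disjoint hab

theorem fej_ramanujan {d : ℕ} (hd : 0 < d) (i : ℤ) :
    ∑ z ∈ primitiveRoots d ℂ, z ^ (-i) = (ramanujanSum d i : ℂ) := by
  have key := (ArithmeticFunction.sum_eq_iff_sum_mul_moebius_eq
    (f := fun d => ∑ z ∈ primitiveRoots d ℂ, z ^ (-i))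
    (g := fun n => if (n : ℤ) ∣ -i then (n : ℂ) else 0)).1
    (fun n hn => by rw [← fej_roots_split n (fun z => z ^ (-i)), fej_orth hn]) d hd
  rw [← key]
  rw [Nat.sum_divisorsAntidiagonal'
    (fun x y => (ArithmeticFunction.moebius x : ℂ) * (if (y : ℤ) ∣ -i then (y : ℂ) else 0))]
  unfold ramanujanSum
  push_cast
  simp only [mul_ite, mul_zero]
  rw [← Finset.sum_filter]
  refine Finset.sum_congr ?_ fun _ _ => rfl
  ext e
  simp only [mem_filter, Nat.mem_divisors, Int.dvd_neg, Nat.dvd_gcd_iff, Int.natCast_dvd]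
  have := Nat.gcd_pos_of_pos_left i.natAbs hd
  constructor
  · rintro ⟨⟨a, b⟩, c⟩; exact ⟨⟨a, c⟩, this.ne'⟩
  · rintro ⟨⟨a, c⟩, _⟩; exact ⟨⟨a, hd.ne'⟩, c⟩

open PowerSeries in
theorem fej_prod {d q : ℕ} (hd : 0 < d) {z : ℂ} (hz : IsPrimitiveRoot z d) :
    ∏ j ∈ range (d * q), (1 - C (z ^ j) * X : PowerSeries ℂ) = (1 - X ^ d) ^ q := by
  have base : ∏ j ∈ range d, (1 - C (z ^ j) * X : PowerSeries ℂ) = 1 - X ^ d := by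
    have hC : IsPrimitiveRoot (C z : PowerSeries ℂ) d :=
      hz.map_of_injective (f := (C : ℂ →+* PowerSeries ℂ)) PowerSeries.C_injective
    have h := hC.pow_sub_pow_eq_prod_sub_mul 1 X hd
    rw [one_pow] at h
    rw [h]
    refine Finset.prod_bij (fun j _ => C z ^ j) ?_ ?_ ?_ ?_
    · intro j _
      rw [Polynomial.mem_nthRootsFinset hd, ← pow_mul, mul_comm, pow_mul, hC.pow_eq_one, one_pow]
    · intro a ha b hb hab
      exact hC.pow_inj (mem_range.1 ha) (mem_range.1 hb) hab
    · intro y hy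
      rw [Polynomial.mem_nthRootsFinset hd] at hy
      have : NeZero d := ⟨hd.ne'⟩
      obtain ⟨j, hj, h⟩ := hC.eq_pow_of_pow_eq_one hy
      exact ⟨j, mem_range.2 hj, h⟩
    · intros; simp
  induction q with
  | zero => simp
  | succ q ih =>
    rw [Nat.mul_succ, Finset.prod_range_add, ih, pow_succ]
    congr 1
    rw [← base]
    refine Finset.prod_congr rfl fun j _ => ?_
    rw [pow_add, pow_mul, hz.pow_eq_one, one_pow, one_mul]

open PowerSeries in
theorem fej_coeff {d q : ℕ} (hd : 0 < d) (hq : 0 < q) {z : ℂ} (hz : IsPrimitiveRoot z d) (m : ℕ) :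
    ∑ l ∈ finsuppAntidiag (univ : Finset (Fin (d * q))) m, ∏ j : Fin (d * q), (z ^ (j : ℕ)) ^ (l j)
      = if d ∣ m then (Nat.choose (q - 1 + m / d) (q - 1) : ℂ) else 0 := by
  have h1 : coeff m (∏ j : Fin (d * q), (mk fun k => (z ^ (j : ℕ)) ^ k : PowerSeries ℂ))
      = ∑ l ∈ finsuppAntidiag (univ : Finset (Fin (d * q))) m, ∏ j : Fin (d * q), (z ^ (j : ℕ)) ^ (l j) := by
    rw [coeff_prod]
    simp
  rw [← h1]
  have geo : ∀ a : ℂ, (mk fun k => a ^ k : PowerSeries ℂ) * (1 - C a * X) = 1 := by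
    intro a
    ext k
    rw [mul_sub, ← mul_assoc, mul_one, map_sub]
    cases k with
    | zero => simp
    | succ k => simp [coeff_succ_mul_X, coeff_one, pow_succ]
  have h2 : (∏ j : Fin (d * q), (mk fun k => (z ^ (j : ℕ)) ^ k : PowerSeries ℂ)) * (1 - X ^ d) ^ q
      = 1 := by
    rw [← fej_prod hd hz, ← Fin.prod_univ_eq_prod_range
      (fun j => (1 - C (z ^ j) * X : PowerSeries ℂ)), ← Finset.prod_mul_distrib]
    exact Finset.prod_eq_one fun j _ => geo _
  obtain ⟨r, rfl⟩ : ∃ r, q = r + 1 := ⟨q - 1, by omega⟩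
  have h3 := congrArg (expand d hd.ne') (mk_add_choose_mul_one_sub_pow_eq_one ℂ r)
  rw [map_mul, map_pow, map_sub, map_one, expand_X] at h3
  have h4 : (∏ j : Fin (d * (r + 1)), (mk fun k => (z ^ (j : ℕ)) ^ k : PowerSeries ℂ))
      = expand d hd.ne' (mk fun n => (Nat.choose (r + n) r : ℂ)) := by
    rw [mul_comm] at h3
    exact left_inv_eq_right_inv h2 h3
  rw [h4, coeff_expand, coeff_mk]
  simp

theorem fej_choose {n m d : ℕ} (hd : 0 < d) (hn : 0 < n) (hdn : d ∣ n) (hdm : d ∣ m) :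
    (n + m) * Nat.choose (n / d - 1 + m / d) (n / d - 1)
      = n * Nat.choose ((n + m) / d) (n / d) := by
  obtain ⟨q, rfl⟩ := hdn
  obtain ⟨s, rfl⟩ := hdm
  rw [← Nat.mul_add, Nat.mul_div_cancel_left _ hd, Nat.mul_div_cancel_left _ hd,
    Nat.mul_div_cancel_left _ hd]
  obtain ⟨r, rfl⟩ : ∃ r, q = r + 1 := ⟨q - 1, by have := Nat.pos_of_mul_pos_left hn; omega⟩
  have := Nat.add_one_mul_choose_eq (r + s) r
  rw [show r + 1 + s = r + s + 1 by ring, Nat.add_sub_cancel, mul_assoc, this]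
  ring

theorem fej_count (n m : ℕ) (hn : 0 < n) (i : ℤ) :
    (n : ℂ) * (Nat.card {l : Fin n → ℕ //
        (∑ j, l j) = m ∧ (∑ j : Fin n, (j : ℤ) * (l j : ℤ)) ≡ i [ZMOD (n : ℤ)]} : ℂ)
    = ∑ z ∈ Polynomial.nthRootsFinset n (1 : ℂ), z ^ (-i) *
        ∑ l ∈ finsuppAntidiag (univ : Finset (Fin n)) m, ∏ j : Fin n, (z ^ (j : ℕ)) ^ (l j) := by
  classical
  have hcard : Nat.card {l : Fin n → ℕ //
        (∑ j, l j) = m ∧ (∑ j : Fin n, (j : ℤ) * (l j : ℤ)) ≡ i [ZMOD (n : ℤ)]}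
      = ((finsuppAntidiag (univ : Finset (Fin n)) m).filter
          (fun l => (n : ℤ) ∣ (∑ j : Fin n, (j : ℤ) * (l j : ℤ)) - i)).card := by
    rw [← Nat.card_eq_finsetCard]
    refine Nat.card_congr ((Finsupp.equivFunOnFinite.symm).subtypeEquiv fun l => ?_)
    simp only [mem_filter, mem_finsuppAntidiag, Finset.subset_univ, and_true]
    refine and_congr (by simp) ?_
    rw [Int.modEq_comm, Int.modEq_iff_dvd]
    simp
  simp_rw [Finset.mul_sum]
  rw [Finset.sum_comm, hcard, Finset.card_filter]
  push_cast
  rw [Finset.mul_sum]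
  refine Finset.sum_congr rfl fun l _ => ?_
  rw [mul_ite, mul_one, mul_zero, ← fej_orth hn]
  refine Finset.sum_congr rfl fun z hz => ?_
  have hz0 : z ≠ 0 := by
    rintro rfl
    rw [Polynomial.mem_nthRootsFinset hn, zero_pow hn.ne'] at hz
    exact zero_ne_one hz
  rw [sub_eq_add_neg, zpow_add₀ hz0, mul_comm]
  congr 1
  simp_rw [← pow_mul]
  rw [Finset.prod_pow_eq_pow_sum, ← zpow_natCast]
  push_cast
  rfl

/-- Fredman / Elashvili–Jibladze formula: for `n ≥ 1`, `m ≥ 0` and any integer `i`,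
`(n+m)·S(n,m,i) = Σ_{d | gcd(n,m)} c_d(i)·binom((n+m)/d, n/d)`, where `S(n,m,i)` is the
number of tuples `(λ_0,…,λ_{n-1})` of nonnegative integers with `Σ λ_j = m` and
`Σ j·λ_j ≡ i (mod n)`. -/
theorem fredman_elashvili_jibladze_formula (n m : ℕ) (hn : 1 ≤ n) (i : ℤ) :
    ((n + m : ℕ) : ℤ) *
      (Nat.card {l : Fin n → ℕ //
        (∑ j, l j) = m ∧ (∑ j : Fin n, (j : ℤ) * (l j : ℤ)) ≡ i [ZMOD (n : ℤ)]} : ℤ) =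
    ∑ d ∈ (Nat.gcd n m).divisors,
      ramanujanSum d i * (Nat.choose ((n + m) / d) (n / d) : ℤ) := by
  have h0 := fej_count n m hn i
  rw [fej_roots_split] at h0
  have h1 : ∀ d ∈ n.divisors, ∑ z ∈ primitiveRoots d ℂ, (z ^ (-i) *
        ∑ l ∈ finsuppAntidiag (univ : Finset (Fin n)) m, ∏ j : Fin n, (z ^ (j : ℕ)) ^ (l j))
      = if d ∣ m then (ramanujanSum d i : ℂ) * (Nat.choose (n / d - 1 + m / d) (n / d - 1) : ℂ)
        else 0 := by
    intro d hd
    obtain ⟨q, rfl⟩ := Nat.dvd_of_mem_divisors hd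
    have hdpos : 0 < d := Nat.pos_of_mem_divisors hd
    have hqpos : 0 < q := Nat.pos_of_mul_pos_left hn
    rw [Nat.mul_div_cancel_left _ hdpos, ← fej_ramanujan hdpos, Finset.sum_mul]
    have : ∀ z ∈ primitiveRoots d ℂ, (z ^ (-i) *
        ∑ l ∈ finsuppAntidiag (univ : Finset (Fin (d * q))) m, ∏ j : Fin (d * q), (z ^ (j : ℕ)) ^ (l j))
        = z ^ (-i) * if d ∣ m then (Nat.choose (q - 1 + m / d) (q - 1) : ℂ) else 0 :=
      fun z hz => by rw [fej_coeff hdpos hqpos (isPrimitiveRoot_of_mem_primitiveRoots hz)]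
    rw [Finset.sum_congr rfl this]
    split_ifs <;> simp
  rw [Finset.sum_congr rfl h1, ← Finset.sum_filter] at h0
  have hdiv : n.divisors.filter (fun d => d ∣ m) = (Nat.gcd n m).divisors := by
    ext d
    have := Nat.gcd_pos_of_pos_left m hn
    simp only [mem_filter, Nat.mem_divisors, Nat.dvd_gcd_iff]
    constructor
    · rintro ⟨⟨a, b⟩, c⟩; exact ⟨⟨a, c⟩, this.ne'⟩
    · rintro ⟨⟨a, c⟩, _⟩; exact ⟨⟨a, by omega⟩, c⟩
  rw [hdiv] at h0
  have hnC : (n : ℂ) ≠ 0 := by exact_mod_cast (by omega : n ≠ 0)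
  have goal : (((n + m : ℕ) : ℂ)) *
      (Nat.card {l : Fin n → ℕ //
        (∑ j, l j) = m ∧ (∑ j : Fin n, (j : ℤ) * (l j : ℤ)) ≡ i [ZMOD (n : ℤ)]} : ℂ) =
    ∑ d ∈ (Nat.gcd n m).divisors,
      (ramanujanSum d i : ℂ) * (Nat.choose ((n + m) / d) (n / d) : ℂ) := by
    apply mul_left_cancel₀ hnC
    rw [mul_left_comm, h0, Finset.mul_sum, Finset.mul_sum]
    refine Finset.sum_congr rfl fun d hd => ?_
    have hg := Nat.dvd_of_mem_divisors hd
    have := fej_choose (Nat.pos_of_mem_divisors hd) hn (hg.trans (Nat.gcd_dvd_left _ _))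
      (hg.trans (Nat.gcd_dvd_right _ _))
    have hc : ((n + m : ℕ) : ℂ) * (Nat.choose (n / d - 1 + m / d) (n / d - 1) : ℂ)
      = n * (Nat.choose ((n + m) / d) (n / d) : ℂ) := by exact_mod_cast this
    rw [mul_left_comm, hc, mul_left_comm]
  exact_mod_cast goal
end

section
/- Fix an integer i. For real numbers x, y, z with |x| + |y| + |z| < 1, define the coefficient D_i(p,q,m) for (p,q,m) ∈ ℕ³ with p+q+m ≥ 1 by: D_i(p,q,m) = T_i(q+m, p, m) if q+m ≥ 1, and D_i(p,0,0) = 1 if p divides i and 0 otherwise (for p ≥ 1). Then the family D_i(p,q,m)·x^p·y^q·z^m is summable, the family (c_d(i)/d)·log(1 − x^d − y^d + (−z)^d) over integers d ≥ 1 is summable, and Σ_{(p,q,m), p+q+m ≥ 1} D_i(p,q,m)·x^p·y^q·z^m = − Σ_{d=1}^∞ (c_d(i)/d)·log(1 − x^d − y^d + (−z)^d). -/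
open Finset

/-- `T_i(n,p,m)`: the number of pairs `(λ, J)` with `λ : Fin n → ℕ` summing to `p`,
`J ⊆ {0,…,n-1}` an `m`-element subset, and `Σ j·λ_j + Σ_{j∈J} j ≡ i (mod n)`. -/
noncomputable def TCount (n p m : ℕ) (i : ℤ) : ℕ :=
  Nat.card {lJ : (Fin n → ℕ) × Finset (Fin n) //
    (∑ j, lJ.1 j) = p ∧ lJ.2.card = m ∧
    ((∑ j : Fin n, (j : ℤ) * (lJ.1 j : ℤ)) + ∑ j ∈ lJ.2, (j : ℤ)) ≡ i [ZMOD (n : ℤ)]}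

/-- The coefficient `D_i(p,q,m)`: equal to `T_i(q+m, p, m)` when `q+m ≥ 1`, and for
`q = m = 0` equal to `1` if `p ∣ i` and `0` otherwise. -/
noncomputable def DCoeff (i : ℤ) (p q m : ℕ) : ℝ :=
  if 1 ≤ q + m then (TCount (q + m) p m i : ℝ)
  else if (p : ℤ) ∣ i then 1 else 0


lemma nthRootsFinset_eq_image_pow {n : ℕ} (hn : 0 < n) {ζ : ℂ} (h : IsPrimitiveRoot ζ n) :
    Polynomial.nthRootsFinset n (1 : ℂ) = (Finset.range n).image (fun j => ζ ^ j) := by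
  symm
  apply Finset.eq_of_subset_of_card_le
  · intro η hη
    obtain ⟨j, -, rfl⟩ := Finset.mem_image.1 hη
    rw [Polynomial.mem_nthRootsFinset hn, ← pow_mul, mul_comm, pow_mul, h.pow_eq_one, one_pow]
  · rw [h.card_nthRootsFinset, Finset.card_image_of_injOn, Finset.card_range]
    intro a ha b hb hab
    exact h.pow_inj (by simpa using ha) (by simpa using hb) hab

lemma pow_injOn_range {n : ℕ} {ζ : ℂ} (h : IsPrimitiveRoot ζ n) :
    Set.InjOn (fun j => ζ ^ j) (Finset.range n : Set ℕ) := by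
  intro a ha b hb hab
  exact h.pow_inj (by simpa using ha) (by simpa using hb) hab

lemma sum_roots_zpow {n : ℕ} (hn : 0 < n) (s : ℤ) :
    ∑ η ∈ Polynomial.nthRootsFinset n (1 : ℂ), η ^ s = if (n : ℤ) ∣ s then (n : ℂ) else 0 := by
  have h := Complex.isPrimitiveRoot_exp n hn.ne'
  set ω := Complex.exp (2 * Real.pi * Complex.I / n) with hω
  rw [nthRootsFinset_eq_image_pow hn h, Finset.sum_image (pow_injOn_range h)]
  have h1 : ∀ j : ℕ, (ω ^ j) ^ s = (ω ^ s) ^ j := by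
    intro j
    rw [← zpow_natCast, ← zpow_natCast, ← zpow_mul, ← zpow_mul, mul_comm]
  simp only [h1]
  split_ifs with hs
  · rw [(h.zpow_eq_one_iff_dvd s).2 hs]; simp
  · have h2 : ω ^ s ≠ 1 := fun h3 => hs ((h.zpow_eq_one_iff_dvd s).1 h3)
    rw [geom_sum_eq h2, ← h1, h.pow_eq_one, one_zpow]; simp

lemma sum_roots_split {n : ℕ} (f : ℂ → ℂ) :
    ∑ η ∈ Polynomial.nthRootsFinset n (1 : ℂ), f η =
      ∑ d ∈ n.divisors, ∑ η ∈ primitiveRoots d ℂ, f η := by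
  rw [IsPrimitiveRoot.nthRoots_one_eq_biUnion_primitiveRoots, Finset.sum_biUnion]
  intro a _ b _ hab
  exact IsPrimitiveRoot.disjoint hab

lemma ramanujan_eq {n : ℕ} (hn : 0 < n) (i : ℤ) :
    ∑ η ∈ primitiveRoots n ℂ, η ^ i = (ramanujanSum n i : ℂ) := by
  have key := (ArithmeticFunction.sum_eq_iff_sum_mul_moebius_eq
    (f := fun d => ∑ η ∈ primitiveRoots d ℂ, η ^ i)
    (g := fun n => if (n : ℤ) ∣ i then (n : ℂ) else 0)).1
    (fun n hn => by rw [← sum_roots_zpow hn, sum_roots_split]) n hn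
  rw [← key, Nat.sum_divisorsAntidiagonal'
    (f := fun a b => ((ArithmeticFunction.moebius a : ℤ) : ℂ) * (if (b : ℤ) ∣ i then (b : ℂ) else 0))]
  unfold ramanujanSum
  push_cast
  symm
  have hsub : (Nat.gcd n i.natAbs).divisors = n.divisors.filter (fun e : ℕ => (e : ℤ) ∣ i) := by
    ext e
    simp [Nat.dvd_gcd_iff, hn.ne', Int.natCast_dvd]
  rw [hsub, Finset.sum_filter]
  refine Finset.sum_congr rfl fun e _ => ?_
  split_ifs <;> simp

lemma ramanujan_neg (n : ℕ) (i : ℤ) : ramanujanSum n (-i) = ramanujanSum n i := by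
  simp [ramanujanSum]

lemma sum_ramanujan {n : ℕ} (hn : 0 < n) (i : ℤ) :
    ∑ d ∈ n.divisors, (ramanujanSum d i : ℝ) = if (n : ℤ) ∣ i then (n : ℝ) else 0 := by
  have h : ∑ d ∈ n.divisors, (ramanujanSum d i : ℂ) = if (n : ℤ) ∣ i then (n : ℂ) else 0 := by
    rw [← sum_roots_zpow hn, sum_roots_split]
    exact Finset.sum_congr rfl fun d hd => (ramanujan_eq (Nat.pos_of_mem_divisors hd) i).symm
  split_ifs at h ⊢ <;> exact_mod_cast h

lemma abs_ramanujan_le (d : ℕ) (i : ℤ) (hd : 0 < d) : |(ramanujanSum d i : ℝ)| ≤ (d : ℝ) ^ 2 := by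
  unfold ramanujanSum
  push_cast
  refine (Finset.abs_sum_le_sum_abs _ _).trans ?_
  have hg : Nat.gcd d i.natAbs ≤ d := Nat.gcd_le_left _ hd
  have : ∀ e ∈ (Nat.gcd d i.natAbs).divisors,
      |((ArithmeticFunction.moebius (d / e) : ℤ) : ℝ) * (e : ℝ)| ≤ d := by
    intro e he
    have h1 : (e : ℝ) ≤ d := by exact_mod_cast (Nat.divisor_le he).trans hg
    have h2 : |((ArithmeticFunction.moebius (d / e) : ℤ) : ℝ)| ≤ 1 := by
      exact_mod_cast ArithmeticFunction.abs_moebius_le_one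
    rw [abs_mul, Nat.abs_cast]
    calc _ ≤ 1 * (e : ℝ) := by gcongr
      _ ≤ d := by simpa using h1
  refine (Finset.sum_le_card_nsmul _ _ _ this).trans ?_
  rw [nsmul_eq_mul, sq]
  gcongr
  exact (Nat.card_divisors_le_self _).trans hg

lemma prod_root {d : ℕ} (hd : 0 < d) {ζ : ℂ} (h : IsPrimitiveRoot ζ d) (N : ℕ) (a b : ℂ) :
    ∏ j : Fin (d * N), (a - b * ζ ^ (j : ℕ)) = (a ^ d - b ^ d) ^ N := by
  rw [Fin.prod_univ_eq_prod_range (fun j => a - b * ζ ^ j)]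
  induction N with
  | zero => simp
  | succ N ih =>
    rw [Nat.mul_succ, Finset.prod_range_add, ih, pow_succ]
    congr 1
    rw [h.pow_sub_pow_eq_prod_sub_mul a b hd, nthRootsFinset_eq_image_pow hd h,
      Finset.prod_image (pow_injOn_range h)]
    refine Finset.prod_congr rfl fun j _ => ?_
    rw [pow_add, pow_mul, h.pow_eq_one, one_pow, one_mul, mul_comm]

lemma hasSum_mul_complex {α β : Type*} {f : α → ℂ} {g : β → ℂ} {a b : ℂ}
    (hf : HasSum f a) (hg : HasSum g b) :
    HasSum (fun t : α × β => f t.1 * g t.2) (a * b) := by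
  have h1 : Summable (fun t => ‖f t‖) := hf.summable.norm
  have h2 : Summable (fun t => ‖g t‖) := hg.summable.norm
  exact HasSum.mul hf hg (summable_mul_of_summable_norm h1 h2)

lemma pi_geom (n : ℕ) (a : Fin n → ℂ) (ha : ∀ j, ‖a j‖ < 1) :
    HasSum (fun l : Fin n → ℕ => ∏ j, a j ^ l j) (∏ j, (1 - a j)⁻¹) := by
  induction n with
  | zero =>
    simp only [Finset.univ_eq_empty, Finset.prod_empty]
    exact hasSum_unique (fun _ : Fin 0 → ℕ => (1 : ℂ))
  | succ n ih =>
    have h1 := hasSum_geometric_of_norm_lt_one (ha 0)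
    have h2 := ih (fun j => a j.succ) (fun j => ha _)
    have h3 := hasSum_mul_complex h1 h2
    rw [Fin.prod_univ_succ, ← (Fin.consEquiv (fun _ : Fin (n + 1) => ℕ)).hasSum_iff]
    convert h3 using 1
    ext l
    simp [Fin.consEquiv, Fin.prod_univ_succ]

lemma char_sum (n : ℕ) (x y z ζ : ℂ) (hζ : ‖ζ‖ = 1) (hx : ‖x‖ < 1) :
    HasSum (fun b : (Fin n → ℕ) × Finset (Fin n) =>
      x ^ (∑ j, b.1 j) * y ^ (n - b.2.card) * z ^ b.2.card *
        ζ ^ (∑ j : Fin n, (j : ℕ) * b.1 j + ∑ j ∈ b.2, (j : ℕ)))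
      ((∏ j : Fin n, (1 - x * ζ ^ (j : ℕ))⁻¹) * ∏ j : Fin n, (z * ζ ^ (j : ℕ) + y)) := by
  have h1 := pi_geom n (fun j => x * ζ ^ (j : ℕ)) (fun j => by simpa [hζ] using hx)
  have h2 := hasSum_fintype (fun J : Finset (Fin n) =>
    z ^ J.card * ζ ^ (∑ j ∈ J, (j : ℕ)) * y ^ (n - J.card))
  have h4 : ∏ j : Fin n, (z * ζ ^ (j : ℕ) + y) = ∑ J : Finset (Fin n),
      z ^ J.card * ζ ^ (∑ j ∈ J, (j : ℕ)) * y ^ (n - J.card) := by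
    rw [Finset.prod_add, Finset.powerset_univ]
    refine Finset.sum_congr rfl fun J _ => ?_
    rw [Finset.prod_mul_distrib, Finset.prod_const, Finset.prod_pow_eq_pow_sum, Finset.prod_const,
      Finset.card_sdiff_of_subset (Finset.subset_univ _), Finset.card_univ, Fintype.card_fin]
  rw [h4]
  have h3 := hasSum_mul_complex h1 h2
  convert h3 using 1
  ext b
  simp only [mul_pow, Finset.prod_mul_distrib, Finset.prod_pow_eq_pow_sum, ← pow_mul, pow_add]
  ring


lemma hasSum_of_eq {α β : Type*} [AddCommMonoid α] [TopologicalSpace α] {f g : β → α} {a b : α}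
    (h : HasSum f a) (hf : ∀ t, g t = f t) (ha : b = a) : HasSum g b := by
  rw [ha, funext hf]
  exact h

/-- The congruence condition. -/
def CongCond (n : ℕ) (i : ℤ) (b : (Fin n → ℕ) × Finset (Fin n)) : Prop :=
  ((∑ j : Fin n, (j : ℤ) * (b.1 j : ℤ)) + ∑ j ∈ b.2, (j : ℤ)) ≡ i [ZMOD (n : ℤ)]

/-- The closed form of the `n`-th sliceVal. -/
noncomputable def sliceVal (w : ℕ → ℝ) (i : ℤ) (n : ℕ) : ℝ :=
  (1 / n : ℝ) * ∑ d ∈ n.divisors, (ramanujanSum d i : ℝ) * w d ^ (n / d)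

open Classical in
lemma slice_hasSum {n : ℕ} (hn : 0 < n) (i : ℤ) (x y z : ℝ) (hx : |x| < 1) :
    HasSum (fun b : (Fin n → ℕ) × Finset (Fin n) =>
      if CongCond n i b then x ^ (∑ j, b.1 j) * y ^ (n - b.2.card) * z ^ b.2.card else 0)
      (sliceVal (fun d => (y ^ d - (-z) ^ d) / (1 - x ^ d)) i n) := by
  have hx' : ‖(x : ℂ)‖ < 1 := by simpa using hx
  have hn0 : (n : ℂ) ≠ 0 := by exact_mod_cast hn.ne'
  have h1 : ∀ η ∈ Polynomial.nthRootsFinset n (1 : ℂ), ‖η‖ = 1 := fun η hη =>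
    Complex.norm_eq_one_of_pow_eq_one ((Polynomial.mem_nthRootsFinset hn _).1 hη) hn.ne'
  have h2 := hasSum_sum (fun η hη =>
    (char_sum n (x : ℂ) y z η (h1 η hη) hx').mul_left (η ^ (-i)))
  have h3 := h2.mul_left (1 / (n : ℂ))
  rw [← Complex.hasSum_ofReal]
  refine hasSum_of_eq h3 (fun b => ?_) ?_
  · set s : ℕ := ∑ j : Fin n, (j : ℕ) * b.1 j + ∑ j ∈ b.2, (j : ℕ) with hs
    have h4 : CongCond n i b ↔ (n : ℤ) ∣ (s : ℤ) + (-i) := by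
      unfold CongCond
      rw [Int.modEq_comm, Int.modEq_iff_dvd, hs]
      push_cast
      rw [sub_eq_add_neg]
    have h5 : ∀ η ∈ Polynomial.nthRootsFinset n (1 : ℂ),
        η ^ (-i) * ((x : ℂ) ^ (∑ j, b.1 j) * (y : ℂ) ^ (n - b.2.card) * (z : ℂ) ^ b.2.card * η ^ s)
        = ((x : ℂ) ^ (∑ j, b.1 j) * (y : ℂ) ^ (n - b.2.card) * (z : ℂ) ^ b.2.card) *
          η ^ ((s : ℤ) + (-i)) := by
      intro η hη
      have : η ≠ 0 := by
        rintro rfl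
        simpa using h1 0 hη
      rw [zpow_add₀ this, zpow_natCast]
      ring
    rw [Finset.sum_congr rfl h5, ← Finset.mul_sum, sum_roots_zpow hn]
    simp only [h4]
    split_ifs
    · push_cast
      field_simp
    · simp
  · unfold sliceVal
    push_cast
    rw [sum_roots_split]
    congr 1
    refine Finset.sum_congr rfl fun d hd => ?_
    have hd0 : 0 < d := Nat.pos_of_mem_divisors hd
    rw [← ramanujan_neg, ← ramanujan_eq hd0, Finset.sum_mul]
    refine Finset.sum_congr rfl fun η hη => ?_
    congr 1
    obtain ⟨N, hN⟩ := Nat.dvd_of_mem_divisors hd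
    have hdiv : n / d = N := by rw [hN, Nat.mul_div_cancel_left _ hd0]
    have hp := (mem_primitiveRoots hd0).1 hη
    rw [hdiv]
    clear h2 h3 h1 hdiv
    subst hN
    have e1 := prod_root hd0 hp N 1 (x : ℂ)
    have e2 := prod_root hd0 hp N (y : ℂ) (-(z : ℂ))
    rw [Finset.prod_inv_distrib, e1]
    have e3 : ∏ j : Fin (d * N), ((z : ℂ) * η ^ (j : ℕ) + y) =
        ∏ j : Fin (d * N), ((y : ℂ) - (-z) * η ^ (j : ℕ)) :=
      Finset.prod_congr rfl fun j _ => by ring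
    rw [e3, e2, one_pow, div_pow]
    ring

lemma total_hasSum (n : ℕ) (x y z : ℝ) (hx : |x| < 1) :
    HasSum (fun b : (Fin n → ℕ) × Finset (Fin n) =>
      x ^ (∑ j, b.1 j) * y ^ (n - b.2.card) * z ^ b.2.card)
      (((y + z) / (1 - x)) ^ n) := by
  have hx' : ‖(x : ℂ)‖ < 1 := by simpa using hx
  have h := char_sum n (x : ℂ) y z 1 (by simp) hx'
  rw [← Complex.hasSum_ofReal]
  refine hasSum_of_eq h (fun b => ?_) ?_
  · simp
  · simp [div_eq_mul_inv, mul_pow]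
    ring

lemma count_hasSum {n : ℕ} (hn : 0 < n) (i : ℤ) (x y z : ℝ) (hx : |x| < 1) :
    HasSum (fun t : ℕ × ℕ => (TCount n t.1 t.2 i : ℝ) * x ^ t.1 * y ^ (n - t.2) * z ^ t.2)
      (sliceVal (fun d => (y ^ d - (-z) ^ d) / (1 - x ^ d)) i n) := by
  classical
  have h := (slice_hasSum hn i x y z hx).tsum_fiberwise (fun b => (∑ j, b.1 j, b.2.card))
  refine hasSum_of_eq h ?_ rfl
  rintro ⟨p, m⟩
  dsimp only
  have e : ∑' _ : {lJ : (Fin n → ℕ) × Finset (Fin n) |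
    (∑ j, lJ.1 j) = p ∧ lJ.2.card = m ∧
    ((∑ j : Fin n, (j : ℤ) * (lJ.1 j : ℤ)) + ∑ j ∈ lJ.2, (j : ℤ)) ≡ i [ZMOD (n : ℤ)]},
      (x ^ p * y ^ (n - m) * z ^ m) = (TCount n p m i : ℝ) * x ^ p * y ^ (n - m) * z ^ m := by
    rw [tsum_const, nsmul_eq_mul, TCount]
    simp only [Set.coe_ofPred]
    ring
  rw [← e]
  rw [_root_.tsum_subtype _ (fun _ => x ^ p * y ^ (n - m) * z ^ m),
    _root_.tsum_subtype _ (fun b : (Fin n → ℕ) × Finset (Fin n) =>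
      if CongCond n i b then x ^ (∑ j, b.1 j) * y ^ (n - b.2.card) * z ^ b.2.card else 0)]
  refine tsum_congr fun b => ?_
  simp only [Set.indicator_apply, Set.mem_ofPred_eq, Set.mem_preimage, Set.mem_singleton_iff,
    Prod.mk.injEq, CongCond]
  by_cases h1 : ∑ j, b.1 j = p
  · by_cases h2 : b.2.card = m
    · simp [h1, h2]
    · simp [h2]
  · simp [h1]

lemma slice_le {n : ℕ} (hn : 0 < n) (i : ℤ) (x y z : ℝ) (hx : x < 1) (hx0 : 0 ≤ x) (hy : 0 ≤ y)
    (hz : 0 ≤ z) :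
    sliceVal (fun d => (y ^ d - (-z) ^ d) / (1 - x ^ d)) i n ≤ ((y + z) / (1 - x)) ^ n := by
  classical
  have hx' : |x| < 1 := by rwa [abs_of_nonneg hx0]
  refine hasSum_le ?_ (slice_hasSum hn i x y z hx') (total_hasSum n x y z hx')
  intro b
  split_ifs
  · exact le_rfl
  · positivity

lemma log_side (i : ℤ) (w : ℕ → ℝ) (ρ : ℝ) (h0 : 0 ≤ ρ) (h1 : ρ < 1)
    (hw : ∀ d, 0 < d → |w d| ≤ ρ ^ d) :
    ∃ S, HasSum (fun d : ℕ+ => (ramanujanSum d i : ℝ) / (d : ℕ) * (-Real.log (1 - w d))) S ∧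
      HasSum (fun n : ℕ+ => sliceVal w i n) S := by
  let f : ℕ+ × ℕ+ → ℝ := fun t =>
    (ramanujanSum t.1 i : ℝ) / (t.1 : ℕ) * (w t.1 ^ (t.2 : ℕ) / (t.2 : ℕ))
  have hf : Summable f := by
    have hs := summable_prod_mul_pow 1 (r := ρ) (by rwa [Real.norm_of_nonneg h0])
    have hs' := (Equiv.prodComm ℕ+ ℕ+).summable_iff.2 hs
    refine Summable.of_norm_bounded hs' ?_
    rintro ⟨d, N⟩
    simp only [f, Function.comp, Equiv.prodComm_apply, Prod.swap]
    have hd : (0 : ℝ) < (d : ℕ) := by exact_mod_cast d.pos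
    have hN : (1 : ℝ) ≤ (N : ℕ) := by exact_mod_cast N.pos
    rw [norm_mul, norm_div, norm_div, norm_pow]
    simp only [Real.norm_eq_abs, Nat.abs_cast]
    have a1 : |(ramanujanSum d i : ℝ)| / (d : ℕ) ≤ ((d : ℕ) : ℝ) ^ 1 := by
      rw [div_le_iff₀ hd]
      have := abs_ramanujan_le d i d.pos
      nlinarith
    have a2 : |w d| ^ (N : ℕ) / (N : ℕ) ≤ ρ ^ ((N : ℕ) * (d : ℕ)) := by
      refine (div_le_self (by positivity) hN).trans ?_
      rw [mul_comm, pow_mul]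
      exact pow_le_pow_left₀ (abs_nonneg _) (hw d d.pos) _
    exact mul_le_mul a1 a2 (by positivity) (by positivity)
  refine ⟨∑' t, f t, ?_, ?_⟩
  · refine hf.hasSum.prod_fiberwise fun d => ?_
    have hlt : |w d| < 1 := (hw d d.pos).trans_lt (pow_lt_one₀ h0 h1 d.ne_zero)
    have hl := Real.hasSum_pow_div_log_of_abs_lt_one hlt
    refine HasSum.mul_left _ ?_
    rw [← Equiv.pnatEquivNat.symm.hasSum_iff]
    refine hasSum_of_eq hl (fun n => ?_) rfl
    simp
  · have hg := (sigmaAntidiagonalEquivProd.hasSum_iff (f := f)).2 hf.hasSum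
    refine hg.sigma fun n => ?_
    have : sliceVal w i n = ∑ c : (n : ℕ).divisorsAntidiagonal,
        (f ∘ sigmaAntidiagonalEquivProd) ⟨n, c⟩ := by
      have e : ∀ c : (n : ℕ).divisorsAntidiagonal, (f ∘ sigmaAntidiagonalEquivProd) ⟨n, c⟩ =
          (fun c : ℕ × ℕ => (ramanujanSum c.1 i : ℝ) / (c.1 : ℕ) * (w c.1 ^ c.2 / (c.2 : ℕ))) c.1 :=
        fun c => rfl
      rw [Finset.sum_congr rfl fun c _ => e c, Finset.sum_coe_sort (n : ℕ).divisorsAntidiagonal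
        (fun c : ℕ × ℕ => (ramanujanSum c.1 i : ℝ) / (c.1 : ℕ) * (w c.1 ^ c.2 / (c.2 : ℕ)))]
      unfold sliceVal
      rw [← Nat.sum_divisorsAntidiagonal (fun d N => (ramanujanSum d i : ℝ) * w d ^ N),
        Finset.mul_sum]
      refine Finset.sum_congr rfl fun c hc => ?_
      have hc' := (Nat.mem_divisorsAntidiagonal.1 hc).1
      rw [← hc']
      push_cast
      ring
    rw [this]
    exact hasSum_fintype _


lemma sub_pow_ge (a : ℝ) (h0 : 0 ≤ a) (h1 : a < 1) {d : ℕ} (hd : 0 < d) :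
    (1 - a) ^ d ≤ 1 - a ^ d := by
  have := pow_add_pow_le h0 (by linarith : 0 ≤ 1 - a) hd.ne'
  simp at this
  linarith

lemma w_bound (x y z : ℝ) (hx : |x| < 1) {d : ℕ} (hd : 0 < d) :
    |(y ^ d - (-z) ^ d) / (1 - x ^ d)| ≤ ((|y| + |z|) / (1 - |x|)) ^ d := by
  have h1 : 0 < 1 - |x| := by linarith
  have h2 := sub_pow_ge |x| (abs_nonneg x) hx hd
  have h3 : x ^ d ≤ |x| ^ d := by rw [← abs_pow]; exact le_abs_self _
  have h4 : |1 - x ^ d| = 1 - x ^ d := abs_of_nonneg (by linarith [pow_pos h1 d])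
  rw [abs_div, div_pow, h4]
  have h5 : |y ^ d - (-z) ^ d| ≤ (|y| + |z|) ^ d := by
    refine (abs_sub _ _).trans ?_
    rw [abs_pow, abs_pow, abs_neg]
    exact pow_add_pow_le (abs_nonneg y) (abs_nonneg z) hd.ne'
  exact div_le_div₀ (by positivity) h5 (pow_pos h1 d) (by linarith)

lemma TCount_eq_zero {n p m : ℕ} (i : ℤ) (h : n < m) : TCount n p m i = 0 := by
  unfold TCount
  rw [Nat.card_eq_zero]
  left
  refine ⟨fun b => ?_⟩
  have h1 := Finset.card_le_univ b.1.2
  have h2 := b.2.2.1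
  rw [Fintype.card_fin] at h1
  omega

lemma triple_hasSum (i : ℤ) (x y z : ℝ) (h : |x| + |y| + |z| < 1) {S : ℝ}
    (hS : HasSum (fun n : ℕ+ => sliceVal (fun d => (y ^ d - (-z) ^ d) / (1 - x ^ d)) i n) S) :
    HasSum (fun t : ℕ+ × (ℕ × ℕ) => (TCount t.1 t.2.1 t.2.2 i : ℝ) * x ^ t.2.1 *
      y ^ ((t.1 : ℕ) - t.2.2) * z ^ t.2.2) S := by
  have hx : |x| < 1 := by linarith [abs_nonneg y, abs_nonneg z]
  have hx' : |(|x|)| < 1 := by rwa [abs_abs]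
  have h1 : 0 < 1 - |x| := by linarith
  have hρ0 : 0 ≤ (|y| + |z|) / (1 - |x|) := by positivity
  have hρ1 : (|y| + |z|) / (1 - |x|) < 1 := by rw [div_lt_one h1]; linarith
  have hsum : Summable (fun t : ℕ+ × (ℕ × ℕ) => (TCount t.1 t.2.1 t.2.2 i : ℝ) * x ^ t.2.1 *
      y ^ ((t.1 : ℕ) - t.2.2) * z ^ t.2.2) := by
    have habs : Summable (fun t : ℕ+ × (ℕ × ℕ) => (TCount t.1 t.2.1 t.2.2 i : ℝ) * |x| ^ t.2.1 *
        |y| ^ ((t.1 : ℕ) - t.2.2) * |z| ^ t.2.2) := by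
      rw [summable_prod_of_nonneg (fun t => by simp only [Pi.zero_apply]; positivity)]
      have hc := fun n : ℕ+ => count_hasSum n.pos i (|x|) (|y|) (|z|) hx'
      refine ⟨fun n => (hc n).summable, ?_⟩
      have hg : Summable (fun n : ℕ+ => ((|y| + |z|) / (1 - |x|)) ^ (n : ℕ)) :=
        (summable_geometric_of_lt_one hρ0 hρ1).comp_injective PNat.coe_injective
      refine Summable.of_nonneg_of_le (fun n => tsum_nonneg fun t => by positivity) (fun n => ?_) hg
      dsimp only
      rw [(hc n).tsum_eq]
      exact slice_le n.pos i _ _ _ hx (abs_nonneg _) (abs_nonneg _) (abs_nonneg _)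
    refine Summable.of_norm_bounded habs fun t => ?_
    simp [abs_mul, abs_pow]
  have h2 := hsum.hasSum.prod_fiberwise (fun n => count_hasSum n.pos i x y z hx)
  rw [← h2.unique hS]
  exact hsum.hasSum

lemma divisor_part (i : ℤ) (x : ℝ) (n : ℕ) (hn : 0 < n) :
    sliceVal (fun d => x ^ d) i n = (if (n : ℤ) ∣ i then 1 else 0) * x ^ n := by
  unfold sliceVal
  have : ∀ d ∈ n.divisors, (ramanujanSum d i : ℝ) * (x ^ d) ^ (n / d) =
      (ramanujanSum d i : ℝ) * x ^ n := by
    intro d hd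
    rw [← pow_mul, Nat.mul_div_cancel' (Nat.dvd_of_mem_divisors hd)]
  rw [Finset.sum_congr rfl this, ← Finset.sum_mul, sum_ramanujan hn]
  have : (n : ℝ) ≠ 0 := by exact_mod_cast hn.ne'
  split_ifs
  · field_simp
  · simp

lemma coeff_hasSum (i : ℤ) (x y z : ℝ) (h : |x| + |y| + |z| < 1) {S1 S2 : ℝ}
    (hS1 : HasSum (fun n : ℕ+ => sliceVal (fun d => x ^ d) i n) S1)
    (hS2 : HasSum (fun n : ℕ+ => sliceVal (fun d => (y ^ d - (-z) ^ d) / (1 - x ^ d)) i n) S2) :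
    HasSum (fun t : {t : ℕ × ℕ × ℕ // 1 ≤ t.1 + t.2.1 + t.2.2} =>
      DCoeff i t.val.1 t.val.2.1 t.val.2.2 * x ^ t.val.1 * y ^ t.val.2.1 * z ^ t.val.2.2)
      (S1 + S2) := by
  let U := {t : ℕ × ℕ × ℕ // 1 ≤ t.1 + t.2.1 + t.2.2}
  let V := {t : ℕ × ℕ × ℕ // 1 ≤ t.2.1 + t.2.2}
  let D : U → ℝ := fun t =>
      DCoeff i t.val.1 t.val.2.1 t.val.2.2 * x ^ t.val.1 * y ^ t.val.2.1 * z ^ t.val.2.2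
  let e1 : ℕ+ → U := fun n => ⟨(n, 0, 0), by have := n.pos; dsimp only; omega⟩
  let e2 : V → U := fun t => ⟨t.1, by have := t.2; omega⟩
  let e3 : V → ℕ+ × (ℕ × ℕ) := fun t => (⟨t.1.2.1 + t.1.2.2, t.2⟩, (t.1.1, t.1.2.2))
  have i1 : Function.Injective e1 := by
    intro a b hab
    have := congrArg (fun t : U => t.1.1) hab
    exact PNat.coe_injective this
  have i2 : Function.Injective e2 := by
    intro a b hab
    exact Subtype.ext (congrArg (fun t : U => t.1) hab)
  have i3 : Function.Injective e3 := by
    rintro ⟨⟨p, q, m⟩, ha⟩ ⟨⟨p', q', m'⟩, hb⟩ hab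
    have c1 := congrArg (fun t : ℕ+ × (ℕ × ℕ) => (t.1 : ℕ)) hab
    have c2 := congrArg (fun t : ℕ+ × (ℕ × ℕ) => t.2.1) hab
    have c3 := congrArg (fun t : ℕ+ × (ℕ × ℕ) => t.2.2) hab
    simp only [e3, PNat.mk_coe] at c1 c2 c3
    have c4 : q = q' := by omega
    subst c2 c3 c4
    rfl
  -- part with `q + m = 0`
  have hA : HasSum (fun t : U => if 1 ≤ t.1.2.1 + t.1.2.2 then 0 else D t) S1 := by
    refine (i1.hasSum_iff ?_).1 (hasSum_of_eq hS1 (fun n => ?_) rfl)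
    · rintro ⟨⟨p, q, m⟩, ht⟩ hr
      dsimp only at ht ⊢
      split_ifs with hc
      · rfl
      · exfalso
        apply hr
        have hq : q = 0 := by omega
        have hm : m = 0 := by omega
        subst hq hm
        exact ⟨⟨p, by omega⟩, rfl⟩
    · rw [divisor_part i x n n.pos]
      simp [e1, D, DCoeff]
  have hB : HasSum (fun t : U => if 1 ≤ t.1.2.1 + t.1.2.2 then D t else 0) S2 := by
    have h3 := (i3.hasSum_iff ?_).2 (triple_hasSum i x y z h hS2)
    · refine (i2.hasSum_iff ?_).1 (hasSum_of_eq h3 (fun t => ?_) rfl)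
      · rintro ⟨⟨p, q, m⟩, ht⟩ hr
        dsimp only
        split_ifs with hc
        · exact absurd ⟨⟨(p, q, m), hc⟩, rfl⟩ hr
        · rfl
      · have ht := t.2
        simp [e2, e3, D, DCoeff, ht]
    · rintro ⟨n, p, m⟩ hr
      have : TCount n p m i = 0 := by
        apply TCount_eq_zero
        by_contra hle
        apply hr
        refine ⟨⟨(p, n - m, m), ?_⟩, ?_⟩
        · have := n.pos
          dsimp only
          omega
        · refine Prod.ext ?_ rfl
          apply PNat.coe_injective
          change (n : ℕ) - m + m = n
          omega
      simp [this]
  refine hasSum_of_eq (hA.add hB) (fun t => ?_) rfl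
  change D t = _
  split_ifs <;> simp

lemma log_hasSum (i : ℤ) (x y z : ℝ) (h : |x| + |y| + |z| < 1) {S1 S2 : ℝ}
    (hS1 : HasSum (fun d : ℕ+ => (ramanujanSum d i : ℝ) / (d : ℕ) *
      (-Real.log (1 - x ^ (d : ℕ)))) S1)
    (hS2 : HasSum (fun d : ℕ+ => (ramanujanSum d i : ℝ) / (d : ℕ) *
      (-Real.log (1 - (y ^ (d : ℕ) - (-z) ^ (d : ℕ)) / (1 - x ^ (d : ℕ))))) S2) :
    HasSum (fun d : {d : ℕ // 1 ≤ d} =>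
      (ramanujanSum d.val i : ℝ) / (d.val : ℝ) *
        Real.log (1 - x ^ d.val - y ^ d.val + (-z) ^ d.val)) (-(S1 + S2)) := by
  have hx : |x| < 1 := by linarith [abs_nonneg y, abs_nonneg z]
  have h1 : 0 < 1 - |x| := by linarith
  have hρ0 : 0 ≤ (|y| + |z|) / (1 - |x|) := by positivity
  have hρ1 : (|y| + |z|) / (1 - |x|) < 1 := by rw [div_lt_one h1]; linarith
  have hs := (hS1.add hS2).neg
  refine hasSum_of_eq (β := ℕ+) hs (fun d => ?_) rfl
  change (ramanujanSum (d : ℕ) i : ℝ) / ((d : ℕ) : ℝ) *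
        Real.log (1 - x ^ (d : ℕ) - y ^ (d : ℕ) + (-z) ^ (d : ℕ)) = _
  have hd := d.pos
  set k : ℕ := (d : ℕ)
  have hw := (w_bound x y z hx hd).trans_lt (pow_lt_one₀ hρ0 hρ1 hd.ne')
  have hx1 : 0 < 1 - x ^ k := by
    have : |x ^ k| < 1 := by rw [abs_pow]; exact pow_lt_one₀ (abs_nonneg x) hx hd.ne'
    linarith [le_abs_self (x ^ k)]
  have hw1 : 0 < 1 - (y ^ k - (-z) ^ k) / (1 - x ^ k) := by
    linarith [le_abs_self ((y ^ k - (-z) ^ k) / (1 - x ^ k))]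
  have e : 1 - x ^ k - y ^ k + (-z) ^ k =
      (1 - x ^ k) * (1 - (y ^ k - (-z) ^ k) / (1 - x ^ k)) := by
    field_simp
    ring
  rw [e, Real.log_mul hx1.ne' hw1.ne']
  ring

/-- The generating-function identity
`Σ_{p+q+m ≥ 1} D_i(p,q,m) x^p y^q z^m = − Σ_{d ≥ 1} (c_d(i)/d)·log(1 − x^d − y^d + (−z)^d)`
for `|x| + |y| + |z| < 1`, including summability of both families. -/
theorem log_generating_identity (i : ℤ) (x y z : ℝ) (h : |x| + |y| + |z| < 1) :
    Summable (fun t : {t : ℕ × ℕ × ℕ // 1 ≤ t.1 + t.2.1 + t.2.2} =>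
      DCoeff i t.val.1 t.val.2.1 t.val.2.2 * x ^ t.val.1 * y ^ t.val.2.1 * z ^ t.val.2.2) ∧
    Summable (fun d : {d : ℕ // 1 ≤ d} =>
      (ramanujanSum d.val i : ℝ) / (d.val : ℝ) *
        Real.log (1 - x ^ d.val - y ^ d.val + (-z) ^ d.val)) ∧
    (∑' t : {t : ℕ × ℕ × ℕ // 1 ≤ t.1 + t.2.1 + t.2.2},
        DCoeff i t.val.1 t.val.2.1 t.val.2.2 * x ^ t.val.1 * y ^ t.val.2.1 * z ^ t.val.2.2) =
      - ∑' d : {d : ℕ // 1 ≤ d},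
        (ramanujanSum d.val i : ℝ) / (d.val : ℝ) *
          Real.log (1 - x ^ d.val - y ^ d.val + (-z) ^ d.val) := by
  have hx : |x| < 1 := by linarith [abs_nonneg y, abs_nonneg z]
  have h1 : 0 < 1 - |x| := by linarith
  have hρ0 : 0 ≤ (|y| + |z|) / (1 - |x|) := by positivity
  have hρ1 : (|y| + |z|) / (1 - |x|) < 1 := by rw [div_lt_one h1]; linarith
  obtain ⟨S1, a1, b1⟩ := log_side i (fun d => x ^ d) |x| (abs_nonneg x) hx
    (fun d _ => (abs_pow x d).le)
  obtain ⟨S2, a2, b2⟩ := log_side i (fun d => (y ^ d - (-z) ^ d) / (1 - x ^ d)) _ hρ0 hρ1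
    (fun d hd => w_bound x y z hx hd)
  have hL := coeff_hasSum i x y z h b1 b2
  have hR := log_hasSum i x y z h a1 a2
  refine ⟨hL.summable, hR.summable, ?_⟩
  rw [hL.tsum_eq, hR.tsum_eq, neg_neg]
end

section
/- Let q ≥ 1 and m ≥ 0 be integers such that q is odd or m is odd, and let i be an integer. Then the number of m-element subsets J of {0, 1, …, q+m−1} with Σ_{j∈J} j ≡ i (mod q+m) equals the number of tuples (λ_0, …, λ_{q−1}) of nonnegative integers with λ_0 + ⋯ + λ_{q−1} = m and Σ_{j=0}^{q−1} j·λ_j ≡ i (mod q); moreover it also equals the number of q-element subsets K of {0, 1, …, q+m−1} with Σ_{j∈K} j ≡ i (mod q+m). -/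
open Finset

namespace BA

theorem card_shift_mul {α : Type*} (S : Finset α) (w : α → ℤ) (n m : ℕ) (hn : 0 < n)
    (h : ∀ i : ℤ, (S.filter (fun a => w a ≡ i [ZMOD n])).card
      = (S.filter (fun a => w a ≡ i + m [ZMOD n])).card) (i : ℤ) :
    n * (S.filter (fun a => w a ≡ i [ZMOD n])).card
      = Nat.gcd n m * (S.filter (fun a => w a ≡ i [ZMOD (Nat.gcd n m : ℕ)])).card := by
  classical
  have hk : ∀ (k : ℕ) (i : ℤ), (S.filter (fun a => w a ≡ i [ZMOD n])).card
      = (S.filter (fun a => w a ≡ i + k * m [ZMOD n])).card := by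
    intro k
    induction k with
    | zero => intro i; simp
    | succ k ih =>
      intro i
      rw [ih, h]
      push_cast
      ring_nf
  have hk' : ∀ (k i : ℤ), (S.filter (fun a => w a ≡ i [ZMOD n])).card
      = (S.filter (fun a => w a ≡ i + k * m [ZMOD n])).card := by
    intro k i
    obtain ⟨l, rfl | rfl⟩ := k.eq_nat_or_neg
    · exact hk l i
    · rw [hk l (i + -(l:ℤ) * m)]
      ring_nf
  have hg : ∀ (k i : ℤ), (S.filter (fun a => w a ≡ i [ZMOD n])).card
      = (S.filter (fun a => w a ≡ i + (Nat.gcd n m : ℕ) * k [ZMOD n])).card := by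
    intro k i
    rw [hk' (Nat.gcdB n m * k) i]
    congr 1
    apply Finset.filter_congr
    intro a _
    have e : i + (Nat.gcd n m : ℕ) * k ≡ i + Nat.gcdB n m * k * m [ZMOD n] := by
      rw [Nat.gcd_eq_gcd_ab]
      apply Int.ModEq.symm
      rw [Int.modEq_iff_dvd]
      exact ⟨Nat.gcdA n m * k, by ring⟩
    exact ⟨fun h => h.trans e.symm, fun h => h.trans e⟩
  obtain ⟨n', hn'⟩ := Nat.gcd_dvd_left n m
  have hgpos : 0 < Nat.gcd n m := Nat.gcd_pos_of_pos_left _ hn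
  generalize Nat.gcd n m = g at *
  have hn'pos : 0 < n' := by
    rcases Nat.eq_zero_or_pos n' with h0 | h0
    · subst h0; omega
    · exact h0
  have key : (S.filter (fun a => w a ≡ i [ZMOD g])).card
      = ∑ k ∈ range n', (S.filter (fun a => w a ≡ i + g * k [ZMOD n])).card := by
    rw [← Finset.card_biUnion]
    · congr 1
      ext a
      simp only [mem_filter, mem_biUnion, mem_range]
      constructor
      · rintro ⟨ha, hw⟩
        obtain ⟨z, hz⟩ := hw.symm.dvd
        have hp : (0:ℤ) < n' := by exact_mod_cast hn'pos
        refine ⟨(z % n').toNat, ?_, ha, ?_⟩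
        · have := Int.emod_lt_of_pos z hp
          have := Int.emod_nonneg z hp.ne'
          omega
        · rw [Int.toNat_of_nonneg (Int.emod_nonneg z hp.ne')]
          apply Int.ModEq.symm
          rw [Int.modEq_iff_dvd]
          refine ⟨z / n', ?_⟩
          have := Int.emod_add_mul_ediv z n'
          rw [hn']
          push_cast
          linear_combination hz - (g:ℤ) * this
      · rintro ⟨k, _, ha, hw⟩
        refine ⟨ha, ?_⟩
        have h2 : w a ≡ i + g * k [ZMOD g] := hw.of_dvd (by rw [hn']; push_cast; exact Dvd.intro _ rfl)
        exact h2.trans (by simp [Int.ModEq])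
    · intro x hx y hy hxy
      rw [Function.onFun, Finset.disjoint_left]
      intro a h1 h2
      apply hxy
      have h3 := (mem_filter.1 h1).2.symm.trans (mem_filter.1 h2).2
      have h4 : (g:ℤ) * x ≡ g * y [ZMOD (g * n')] := by
        rw [hn'] at h3; push_cast at h3
        exact Int.ModEq.add_left_cancel' _ h3
      have h5 : (x:ℤ) ≡ y [ZMOD n'] := Int.ModEq.mul_left_cancel' (by positivity) h4
      have h6 := Int.natCast_modEq_iff.1 h5
      exact Nat.ModEq.eq_of_lt_of_lt h6 (by simpa using hx) (by simpa using hy)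
  rw [key, Finset.sum_congr rfl (fun (k : ℕ) _ => (hg k i).symm)]
  simp only [sum_const, card_range, smul_eq_mul]
  rw [← mul_assoc, ← hn']

/-- tuples -/
theorem tuple_subset (p : ℕ) : ∀ (m : ℕ) (f : ℕ → ℕ),
    ∑ l ∈ Finset.Nat.antidiagonalTuple (p+1) m, f ((∑ j : Fin (p+1), (j:ℕ) * l j) + m * (m-1)/2)
      = ∑ J ∈ powersetCard m (range (p+m)), f (∑ j ∈ J, j) := by
  induction p with
  | zero =>
    intro m f
    have h := Finset.powersetCard_self (range m)
    rw [card_range] at h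
    rw [show (0 + m) = m from zero_add m, h, sum_singleton, Finset.sum_range_id]
    simp [Finset.Nat.antidiagonalTuple_one]
  | succ p ihp =>
    intro m
    induction m with
    | zero =>
      intro f
      rw [Finset.Nat.antidiagonalTuple_zero_right]
      simp
    | succ m ihm =>
      intro f
      have h1 : ∑ J ∈ powersetCard (m+1) (range (p+1+(m+1))), f (∑ j ∈ J, j)
          = ∑ J ∈ powersetCard (m+1) (range (p+(m+1))), f (∑ j ∈ J, j)
          + ∑ J ∈ powersetCard m (range (p+1+m)), f ((∑ j ∈ J, j) + (p+1+m)) := by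
        rw [show p+1+(m+1) = (p+1+m)+1 by ring, Finset.range_add_one,
          Finset.powersetCard_succ_insert (by simp), Finset.sum_union, Finset.sum_image]
        · congr 1
          · rw [show p+1+m = p+(m+1) by ring]
          · apply Finset.sum_congr rfl
            intro J hJ
            have : p+1+m ∉ J := fun h => by
              have := (mem_powersetCard.1 hJ).1 h
              simp at this
            rw [Finset.sum_insert this, add_comm]
        · intro J hJ K hK h
          have a1 : p+1+m ∉ J := fun h => by
              have := (mem_powersetCard.1 hJ).1 h
              simp at this
          have a2 : p+1+m ∉ K := fun h => by
              have := (mem_powersetCard.1 hK).1 h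
              simp at this
          rw [← Finset.erase_insert a1, ← Finset.erase_insert a2, h]
        · rw [Finset.disjoint_left]
          intro J hJ hK
          obtain ⟨K, _, rfl⟩ := mem_image.1 hK
          have := (mem_powersetCard.1 hJ).1 (mem_insert_self _ _)
          simp at this
      rw [h1, ← ihp (m+1), ← ihm (fun x => f (x + (p+1+m)))]
      rw [← Finset.sum_filter_add_sum_filter_not _ (fun l => l (Fin.last (p+1)) = 0)]
      congr 1
      · refine Finset.sum_bij' (fun l _ => fun j => l j.castSucc) (fun l _ => Fin.snoc (α := fun _ => ℕ) l 0)
          ?_ ?_ ?_ ?_ ?_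
        · intro l hl
          simp only [mem_filter, Finset.Nat.mem_antidiagonalTuple] at hl ⊢
          rw [Fin.sum_univ_castSucc] at hl
          omega
        · intro l hl
          simp only [mem_filter, Finset.Nat.mem_antidiagonalTuple] at hl ⊢
          rw [Fin.sum_univ_castSucc]
          simpa using hl
        · intro l hl
          have h0 := (mem_filter.1 hl).2
          ext j
          refine Fin.lastCases ?_ (fun j => ?_) j
          · simp [h0]
          · simp
        · intro l hl
          ext j
          simp
        · intro l hl
          have h0 := (mem_filter.1 hl).2
          rw [Fin.sum_univ_castSucc]
          simp [h0]
      · refine Finset.sum_bij' (fun l _ => fun j => l j - if j = Fin.last (p+1) then 1 else 0)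
          (fun l _ => fun j => l j + if j = Fin.last (p+1) then 1 else 0)
          ?_ ?_ ?_ ?_ ?_
        · intro l hl
          simp only [mem_filter, Finset.Nat.mem_antidiagonalTuple] at hl ⊢
          rw [Fin.sum_univ_castSucc] at hl ⊢
          simp [Fin.castSucc_ne_last]
          omega
        · intro l hl
          simp only [mem_filter, Finset.Nat.mem_antidiagonalTuple] at hl ⊢
          rw [Finset.sum_add_distrib]
          simp [hl]
        · intro l hl
          have h0 := (mem_filter.1 hl).2
          ext j
          dsimp only
          split_ifs with h
          · subst h; omega
          · simp
        · intro l hl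
          ext j
          simp
        · intro l hl
          have h0 := (mem_filter.1 hl).2
          beta_reduce
          congr 1
          rw [Fin.sum_univ_castSucc (n := p+1), Fin.sum_univ_castSucc (n := p+1)]
          simp only [Fin.castSucc_ne_last, if_false, if_true, Fin.val_last, Nat.sub_zero]
          have e : (m+1)*(m+1-1)/2 = m*(m-1)/2 + m := by
            have := Finset.sum_range_id (m+1)
            rw [Finset.sum_range_succ, Finset.sum_range_id] at this
            exact this.symm
          rw [e]
          obtain ⟨t, ht⟩ : ∃ t, l (Fin.last (p+1)) = t + 1 := ⟨_, (Nat.succ_pred h0).symm⟩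
          rw [ht]
          simp only [Nat.add_sub_cancel]
          ring

theorem dvd_tri (g k : ℕ) (h : g ∣ k) (ho : Odd g ∨ Odd k) : g ∣ k * (k-1) / 2 := by
  have h2 : 2 ∣ k * (k-1) := (Nat.even_mul_pred_self k).two_dvd
  obtain ⟨t, ht⟩ := h2
  rw [ht, Nat.mul_div_cancel_left _ (by norm_num)]
  rcases ho with ho | ho
  · have : g ∣ 2 * t := ht ▸ (h.mul_right _)
    exact (Nat.Coprime.dvd_of_dvd_mul_left (Nat.coprime_two_right.2 ho) this)
  · obtain ⟨s, rfl⟩ := ho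
    have : t = (2*s+1) * s := by
      have e : 2*s+1-1 = 2*s := by omega
      rw [e] at ht
      nlinarith
    rw [this]
    exact h.mul_right _

theorem val_add_one_modEq (n : ℕ) [NeZero n] (x : Fin n) :
    (((x + 1 : Fin n) : ℕ) : ℤ) ≡ (x:ℤ) + 1 [ZMOD n] := by
  have : ((x + 1 : Fin n) : ℕ) ≡ (x:ℕ) + 1 [MOD n] := by
    rw [Fin.val_add, Nat.ModEq, Nat.mod_mod, Fin.val_one', Nat.add_mod_mod]
  exact_mod_cast Int.natCast_modEq_iff.2 this

theorem val_neg_modEq (n : ℕ) [NeZero n] (x : Fin n) :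
    (((-x : Fin n) : ℕ) : ℤ) ≡ -(x:ℤ) [ZMOD n] := by
  rw [Fin.val_neg']
  have h1 : ((((n - (x:ℕ)) % n : ℕ)) : ℤ) ≡ ((n - (x:ℕ) : ℕ) : ℤ) [ZMOD n] :=
    Int.natCast_modEq_iff.2 (Nat.mod_modEq _ _)
  refine h1.trans ?_
  rw [Nat.cast_sub x.2.le]
  simp [Int.ModEq]

theorem sum_modEq {α : Type*} (s : Finset α) (f g : α → ℤ) (n : ℤ)
    (h : ∀ a ∈ s, f a ≡ g a [ZMOD n]) : ∑ a ∈ s, f a ≡ ∑ a ∈ s, g a [ZMOD n] := by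
  rw [Int.modEq_iff_dvd, ← Finset.sum_sub_distrib]
  exact Finset.dvd_sum fun a ha => (h a ha).dvd

theorem sum_shift (n m : ℕ) [NeZero n] (J : Finset (Fin n)) (hJ : J.card = m) :
    ∑ j ∈ J.map (Equiv.addRight (1 : Fin n)).toEmbedding, (j:ℤ) ≡ (∑ j ∈ J, (j:ℤ)) + m [ZMOD n] := by
  rw [Finset.sum_map]
  refine (sum_modEq _ _ (fun j : Fin n => (j:ℤ) + 1) _ fun j _ => val_add_one_modEq n j).trans ?_
  rw [Finset.sum_add_distrib]
  simp [hJ]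

theorem sum_neg (n : ℕ) [NeZero n] (J : Finset (Fin n)) :
    ∑ j ∈ J.map (Equiv.neg (Fin n)).toEmbedding, (j:ℤ) ≡ -(∑ j ∈ J, (j:ℤ)) [ZMOD n] := by
  rw [Finset.sum_map, ← Finset.sum_neg_distrib]
  exact sum_modEq _ _ _ _ fun j _ => val_neg_modEq n j

theorem modEq_iff_of {n a b c d : ℤ} (h : a ≡ b [ZMOD n]) (h' : c ≡ d [ZMOD n]) :
    a ≡ c [ZMOD n] ↔ b ≡ d [ZMOD n] :=
  ⟨fun e => h.symm.trans (e.trans h'), fun e => h.trans (e.trans h'.symm)⟩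

theorem shift_b (n m : ℕ) [NeZero n] (i : ℤ) :
    ((powersetCard m (univ : Finset (Fin n))).filter (fun J : Finset (Fin (n)) => ∑ j ∈ J, (j:ℤ) ≡ i [ZMOD n])).card
    = ((powersetCard m (univ : Finset (Fin n))).filter
        (fun J : Finset (Fin (n)) => ∑ j ∈ J, (j:ℤ) ≡ i + m [ZMOD n])).card := by
  refine Finset.card_equiv (Equiv.addRight (1 : Fin n)).finsetCongr ?_
  intro J
  simp only [mem_filter, mem_powersetCard, subset_univ, true_and, Equiv.finsetCongr_apply, card_map]
  refine and_congr_right fun hJ => ?_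
  rw [modEq_iff_of (sum_shift n m J hJ) (Int.ModEq.refl _)]
  exact ⟨fun h => h.add_right _, fun h => Int.ModEq.add_right_cancel' _ h⟩

theorem neg_b (n m : ℕ) [NeZero n] (i : ℤ) :
    ((powersetCard m (univ : Finset (Fin n))).filter (fun J : Finset (Fin (n)) => ∑ j ∈ J, (j:ℤ) ≡ i [ZMOD n])).card
    = ((powersetCard m (univ : Finset (Fin n))).filter
        (fun J : Finset (Fin (n)) => ∑ j ∈ J, (j:ℤ) ≡ -i [ZMOD n])).card := by
  refine Finset.card_equiv (Equiv.neg (Fin n)).finsetCongr ?_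
  intro J
  simp only [mem_filter, mem_powersetCard, subset_univ, true_and, Equiv.finsetCongr_apply, card_map]
  refine and_congr_right fun hJ => ?_
  rw [modEq_iff_of (sum_neg n J) (Int.ModEq.refl _)]
  exact ⟨fun h => h.neg, fun h => by simpa using h.neg⟩

theorem compl_b (q m : ℕ) (i : ℤ) :
    ((powersetCard m (univ : Finset (Fin (q+m)))).filter
      (fun J : Finset (Fin (q+m)) => ∑ j ∈ J, (j:ℤ) ≡ i [ZMOD (q+m : ℕ)])).card
    = ((powersetCard q (univ : Finset (Fin (q+m)))).filter
        (fun J : Finset (Fin (q+m)) => ∑ j ∈ J, (j:ℤ) ≡ (((q+m)*(q+m-1)/2 : ℕ) : ℤ) - i [ZMOD (q+m : ℕ)])).card := by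
  refine Finset.card_equiv (compl_involutive (α := Finset (Fin (q+m)))).toPerm ?_
  intro J
  simp only [mem_filter, mem_powersetCard, subset_univ, true_and, Function.Involutive.coe_toPerm,
    card_compl, Fintype.card_fin]
  have hc := Finset.card_le_univ J
  rw [Fintype.card_fin] at hc
  refine and_congr (by omega) ?_
  have h1 := Finset.sum_add_sum_compl J (fun j : Fin (q+m) => (j:ℤ))
  have h2 : ∑ j : Fin (q+m), (j:ℤ) = (((q+m)*(q+m-1)/2 : ℕ) : ℤ) := by
    rw [← Finset.sum_range_id, ← Fin.sum_univ_eq_sum_range]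
    push_cast; rfl
  rw [← h2, ← h1]
  constructor
  · intro h
    apply Int.ModEq.symm
    rw [Int.modEq_iff_dvd]
    have := h.dvd
    convert this using 1
    ring
  · intro h
    rw [Int.modEq_iff_dvd]
    have := h.symm.dvd
    convert this using 1
    ring

theorem shift_a (q m : ℕ) [NeZero q] (i : ℤ) :
    ((Finset.Nat.antidiagonalTuple q m).filter
      (fun l => ∑ j : Fin q, (j:ℤ) * (l j : ℤ) ≡ i [ZMOD q])).card
    = ((Finset.Nat.antidiagonalTuple q m).filter
      (fun l => ∑ j : Fin q, (j:ℤ) * (l j : ℤ) ≡ i + m [ZMOD q])).card := by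
  refine Finset.card_equiv (Equiv.arrowCongr (Equiv.addRight (1 : Fin q)) (Equiv.refl ℕ)) ?_
  intro l
  simp only [mem_filter, Finset.Nat.mem_antidiagonalTuple]
  rw [← Equiv.sum_comp (Equiv.addRight (1 : Fin q)) (fun j => (Equiv.arrowCongr (Equiv.addRight (1 : Fin q)) (Equiv.refl ℕ)) l j),
    ← Equiv.sum_comp (Equiv.addRight (1 : Fin q)) (fun j => (j:ℤ) * ((Equiv.arrowCongr (Equiv.addRight (1 : Fin q)) (Equiv.refl ℕ)) l j : ℤ))]
  simp only [Equiv.arrowCongr_apply, Function.comp, Equiv.symm_apply_apply, Equiv.refl_apply]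
  refine and_congr_right fun hl => ?_
  have h : ∑ j : Fin q, ((Equiv.addRight (1 : Fin q) j : Fin q) : ℤ) * (l j : ℤ)
      ≡ ∑ j : Fin q, (j:ℤ) * (l j : ℤ) + m [ZMOD q] := by
    refine (sum_modEq _ _ (fun j : Fin q => ((j:ℤ) + 1) * (l j : ℤ)) _
      fun j _ => (val_add_one_modEq q j).mul_right _).trans ?_
    rw [← hl]
    push_cast
    rw [← Finset.sum_add_distrib]
    simp only [add_mul, one_mul]
    rfl
  rw [modEq_iff_of h (Int.ModEq.refl _)]
  exact ⟨fun h => h.add_right _, fun h => Int.ModEq.add_right_cancel' _ h⟩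

/-- Subsets avoiding a point: independent of the point. -/
theorem avoid_shift (n m g : ℕ) [NeZero n] (hgn : g ∣ n) (hgm : g ∣ m) (i : ℤ) (x : Fin n) :
    ((powersetCard m (univ : Finset (Fin n))).filter
      (fun J : Finset (Fin (n)) => x ∉ J ∧ ∑ j ∈ J, (j:ℤ) ≡ i [ZMOD g])).card
    = ((powersetCard m (univ : Finset (Fin n))).filter
        (fun J : Finset (Fin (n)) => x + 1 ∉ J ∧ ∑ j ∈ J, (j:ℤ) ≡ i [ZMOD g])).card := by
  refine Finset.card_equiv (Equiv.addRight (1 : Fin n)).finsetCongr ?_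
  intro J
  simp only [mem_filter, mem_powersetCard, subset_univ, true_and, Equiv.finsetCongr_apply, card_map]
  refine and_congr_right fun hJ => and_congr (by simp) ?_
  have h := (sum_shift n m J hJ).of_dvd (Int.natCast_dvd_natCast.2 hgn)
  have h' : ∑ j ∈ J.map (Equiv.addRight (1 : Fin n)).toEmbedding, (j:ℤ) ≡ ∑ j ∈ J, (j:ℤ) [ZMOD g] := by
    refine h.trans ?_
    have : (m:ℤ) ≡ 0 [ZMOD g] := Int.modEq_zero_iff_dvd.2 (Int.natCast_dvd_natCast.2 hgm)
    simpa using this.add_left (∑ j ∈ J, (j:ℤ))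
  rw [modEq_iff_of h' (Int.ModEq.refl _)]

theorem avoid_const (n m g : ℕ) [NeZero n] (hgn : g ∣ n) (hgm : g ∣ m) (i : ℤ) (x y : Fin n) :
    ((powersetCard m (univ : Finset (Fin n))).filter
      (fun J : Finset (Fin (n)) => x ∉ J ∧ ∑ j ∈ J, (j:ℤ) ≡ i [ZMOD g])).card
    = ((powersetCard m (univ : Finset (Fin n))).filter
        (fun J : Finset (Fin (n)) => y ∉ J ∧ ∑ j ∈ J, (j:ℤ) ≡ i [ZMOD g])).card := by
  have key : ∀ k : ℕ, ((powersetCard m (univ : Finset (Fin n))).filter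
      (fun J : Finset (Fin (n)) => x ∉ J ∧ ∑ j ∈ J, (j:ℤ) ≡ i [ZMOD g])).card
    = ((powersetCard m (univ : Finset (Fin n))).filter
        (fun J : Finset (Fin (n)) => x + Fin.ofNat n k ∉ J ∧ ∑ j ∈ J, (j:ℤ) ≡ i [ZMOD g])).card := by
    intro k
    induction k with
    | zero => simp
    | succ k ih =>
      rw [ih, avoid_shift n m g hgn hgm]
      have : x + Fin.ofNat n k + 1 = x + Fin.ofNat n (k+1) := by
        ext
        simp [Fin.val_add, Fin.val_one', add_assoc]
      rw [this]
  have := key (y - x : Fin n).val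
  rw [this]
  simp

theorem avoid_count (q m g : ℕ) [NeZero (q+m)] (hgn : g ∣ q+m) (hgm : g ∣ m) (i : ℤ) (x : Fin (q+m)) :
    (q+m) * ((powersetCard m (univ : Finset (Fin (q+m)))).filter
      (fun J : Finset (Fin (q+m)) => x ∉ J ∧ ∑ j ∈ J, (j:ℤ) ≡ i [ZMOD g])).card
    = q * ((powersetCard m (univ : Finset (Fin (q+m)))).filter
        (fun J : Finset (Fin (q+m)) => ∑ j ∈ J, (j:ℤ) ≡ i [ZMOD g])).card := by
  have h1 : ∑ y : Fin (q+m), ((powersetCard m (univ : Finset (Fin (q+m)))).filter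
      (fun J : Finset (Fin (q+m)) => y ∉ J ∧ ∑ j ∈ J, (j:ℤ) ≡ i [ZMOD g])).card
      = (q+m) * ((powersetCard m (univ : Finset (Fin (q+m)))).filter
      (fun J : Finset (Fin (q+m)) => x ∉ J ∧ ∑ j ∈ J, (j:ℤ) ≡ i [ZMOD g])).card := by
    rw [Finset.sum_congr rfl fun y _ => avoid_const (q+m) m g hgn hgm i y x]
    simp
  rw [← h1]
  have h2 : ∀ y : Fin (q+m), ((powersetCard m (univ : Finset (Fin (q+m)))).filter
      (fun J : Finset (Fin (q+m)) => y ∉ J ∧ ∑ j ∈ J, (j:ℤ) ≡ i [ZMOD g])).card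
      = ∑ J ∈ (powersetCard m (univ : Finset (Fin (q+m)))).filter
        (fun J : Finset (Fin (q+m)) => ∑ j ∈ J, (j:ℤ) ≡ i [ZMOD g]), if y ∉ J then 1 else 0 := by
    intro y
    rw [← Finset.card_filter, Finset.filter_filter]
    simp only [and_comm]
  rw [Finset.sum_congr rfl fun y _ => h2 y, Finset.sum_comm]
  have h3 : ∀ J ∈ (powersetCard m (univ : Finset (Fin (q+m)))).filter
        (fun J : Finset (Fin (q+m)) => ∑ j ∈ J, (j:ℤ) ≡ i [ZMOD g]), (∑ y : Fin (q+m), if y ∉ J then 1 else 0) = q := by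
    intro J hJ
    have hc := (mem_powersetCard.1 (mem_filter.1 hJ).1).2
    rw [← Finset.card_filter, Finset.filter_not, Finset.filter_mem_eq_inter, univ_inter,
      ← compl_eq_univ_sdiff, card_compl, hc]
    simp
  rw [Finset.sum_congr rfl h3]
  simp [mul_comm]

theorem avoid_last (p m g : ℕ) (hg : g ∣ m * (m-1)/2) (i : ℤ) :
    ((powersetCard m (univ : Finset (Fin (p+1+m)))).filter
      (fun J : Finset (Fin (p+1+m)) => (⟨p+m, by omega⟩ : Fin (p+1+m)) ∉ J ∧ ∑ j ∈ J, (j:ℤ) ≡ i [ZMOD g])).card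
    = ((Finset.Nat.antidiagonalTuple (p+1) m).filter
      (fun l => ∑ j : Fin (p+1), (j:ℤ) * (l j : ℤ) ≡ i [ZMOD g])).card := by
  have h := tuple_subset p m (fun x => if (x:ℤ) ≡ i [ZMOD g] then 1 else 0)
  rw [← Finset.card_filter, ← Finset.card_filter] at h
  have e : (Finset.Nat.antidiagonalTuple (p+1) m).filter
      (fun l => ∑ j : Fin (p+1), (j:ℤ) * (l j : ℤ) ≡ i [ZMOD g])
      = (Finset.Nat.antidiagonalTuple (p+1) m).filter
      (fun l => ((∑ j : Fin (p+1), (j:ℕ) * l j + m*(m-1)/2 : ℕ) : ℤ) ≡ i [ZMOD g]) := by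
    apply Finset.filter_congr
    intro l _
    apply modEq_iff_of _ (Int.ModEq.refl _)
    have : ((m*(m-1)/2 : ℕ):ℤ) ≡ 0 [ZMOD g] := Int.modEq_zero_iff_dvd.2 (Int.natCast_dvd_natCast.2 hg)
    rw [Nat.cast_add, Nat.cast_sum]
    have h2 := (this.add_left (∑ j : Fin (p+1), (j:ℤ) * (l j : ℤ))).symm
    rw [add_zero] at h2
    simpa only [Nat.cast_mul] using h2
  rw [e, h]
  refine Finset.card_bij (fun J _ => J.map Fin.valEmbedding) ?_ ?_ ?_
  · intro J hJ
    simp only [mem_filter, mem_powersetCard, subset_univ, true_and] at hJ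
    obtain ⟨hc, hx, hs⟩ := hJ
    simp only [mem_filter, mem_powersetCard, card_map, sum_map]
    refine ⟨⟨?_, hc⟩, ?_⟩
    · intro y hy
      obtain ⟨z, hz, rfl⟩ := mem_map.1 hy
      rw [mem_range]
      have h1 := z.2
      have h2 : (z:ℕ) ≠ p+m := by
        intro h3
        apply hx
        have : z = ⟨p+m, by omega⟩ := Fin.ext h3
        rwa [← this]
      simp only [Fin.valEmbedding_apply]
      omega
    · push_cast
      exact hs
  · intro J _ K _ h
    exact Finset.map_injective _ h
  · intro K hK
    simp only [mem_filter, mem_powersetCard] at hK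
    obtain ⟨⟨hsub, hc⟩, hs⟩ := hK
    have hlt : ∀ k ∈ K, k < p+1+m := fun k hk => by
      have := mem_range.1 (hsub hk)
      omega
    have hm : (K.attachFin hlt).map Fin.valEmbedding = K := Finset.map_valEmbedding_attachFin hlt
    refine ⟨K.attachFin hlt, ?_, hm⟩
    simp only [mem_filter, mem_powersetCard, subset_univ, true_and]
    refine ⟨by simpa using hc, ?_, ?_⟩
    · rw [Finset.mem_attachFin]
      intro h
      have := mem_range.1 (hsub h)
      simp at this
    · rw [← hm, sum_map] at hs
      push_cast at hs
      exact hs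

end BA

/-- If `q ≥ 1` and `q` or `m` is odd, then `b_i(C_{q+m}, m) = a_i(C_q, m)` and
`b_i(C_{q+m}, m) = b_i(C_{q+m}, q)`: the number of `m`-element subsets of `{0,…,q+m−1}`
with element sum `≡ i (mod q+m)` equals the number of tuples of `q` nonnegative integers
with sum `m` and weighted sum `≡ i (mod q)`, and also equals the number of `q`-element
subsets of `{0,…,q+m−1}` with element sum `≡ i (mod q+m)`. -/
theorem b_eq_a_of_odd (q m : ℕ) (hq : 1 ≤ q) (hodd : Odd q ∨ Odd m) (i : ℤ) :
    Nat.card {J : Finset (Fin (q + m)) //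
        J.card = m ∧ (∑ j ∈ J, (j : ℤ)) ≡ i [ZMOD ((q + m : ℕ) : ℤ)]} =
      Nat.card {l : Fin q → ℕ //
        (∑ j, l j) = m ∧ (∑ j : Fin q, (j : ℤ) * (l j : ℤ)) ≡ i [ZMOD (q : ℤ)]} ∧
    Nat.card {J : Finset (Fin (q + m)) //
        J.card = m ∧ (∑ j ∈ J, (j : ℤ)) ≡ i [ZMOD ((q + m : ℕ) : ℤ)]} =
      Nat.card {K : Finset (Fin (q + m)) //
        K.card = q ∧ (∑ j ∈ K, (j : ℤ)) ≡ i [ZMOD ((q + m : ℕ) : ℤ)]} := by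
  classical
  have hb : ∀ k : ℕ, Nat.card {J : Finset (Fin (q + m)) //
        J.card = k ∧ (∑ j ∈ J, (j : ℤ)) ≡ i [ZMOD ((q + m : ℕ) : ℤ)]}
      = ((powersetCard k (univ : Finset (Fin (q+m)))).filter
        (fun J : Finset (Fin (q+m)) => ∑ j ∈ J, (j:ℤ) ≡ i [ZMOD (q+m : ℕ)])).card := by
    intro k
    apply Nat.subtype_card
    intro J
    simp
  have ha : Nat.card {l : Fin q → ℕ //
        (∑ j, l j) = m ∧ (∑ j : Fin q, (j : ℤ) * (l j : ℤ)) ≡ i [ZMOD (q : ℤ)]}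
      = ((Finset.Nat.antidiagonalTuple q m).filter
      (fun l => ∑ j : Fin q, (j:ℤ) * (l j : ℤ) ≡ i [ZMOD q])).card := by
    apply Nat.subtype_card
    intro J
    simp [Finset.Nat.mem_antidiagonalTuple]
  rw [hb, hb, ha]
  obtain ⟨p, rfl⟩ : ∃ p, q = p + 1 := ⟨q - 1, by omega⟩
  have : NeZero (p + 1 + m) := ⟨by omega⟩
  have hnpos : 0 < p + 1 + m := by omega
  have g1 : Nat.gcd (p+1+m) m = Nat.gcd (p+1) m := by simp
  have g2 : Nat.gcd (p+1+m) (p+1) = Nat.gcd (p+1) m := by simp [Nat.gcd_comm]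
  have eb := BA.card_shift_mul _ _ _ _ hnpos (BA.shift_b (p+1+m) m) i
  have ebq := BA.card_shift_mul _ _ _ _ hnpos (BA.shift_b (p+1+m) (p+1))
  have ea := BA.card_shift_mul _ _ _ _ hq (BA.shift_a (p+1) m) i
  rw [g1] at eb
  rw [g2] at ebq
  have gq := Nat.gcd_dvd_left (p+1) m
  have gm := Nat.gcd_dvd_right (p+1) m
  have gn : Nat.gcd (p+1) m ∣ p+1+m := Dvd.dvd.add gq gm
  have godd : Odd (Nat.gcd (p+1) m) := hodd.elim (fun h => h.of_dvd_nat gq) (fun h => h.of_dvd_nat gm)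
  have t1 := BA.dvd_tri _ _ gm (Or.inl godd)
  have t2 := BA.dvd_tri _ _ gn (Or.inl godd)
  generalize Nat.gcd (p+1) m = g at *
  constructor
  · have c := BA.avoid_count (p+1) m g gn gm i ⟨p+m, by omega⟩
    rw [BA.avoid_last p m g t1] at c
    apply Nat.eq_of_mul_eq_mul_left (Nat.mul_pos hnpos hq)
    linear_combination (p+1) * eb - (p+1+m) * ea - g * c
  · rw [BA.compl_b, BA.neg_b (p+1+m) (p+1) i]
    apply Nat.eq_of_mul_eq_mul_left hnpos
    rw [ebq, ebq]
    congr 2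
    apply Finset.filter_congr
    intro J _
    apply BA.modEq_iff_of (Int.ModEq.refl _)
    have := (Int.modEq_zero_iff_dvd.2 (Int.natCast_dvd_natCast.2 t2)).sub_right i
    simpa only [zero_sub] using this
end

section
/- Let G be a finite abelian group, written additively, of order n, and let M be a multiset of elements of G with card(M) = n. Then there exists a bijection π : G → G such that M equals the multiset {g + π(g) : g ∈ G} (g ranging over all elements of G) if and only if the sum of the elements of M (with multiplicity) equals 0 in G. Consequently, a monomial ∏_{g∈G} x_g^{k_g} of total degree n occurs in the permanent of the Cayley table of G if and only if Σ_{g∈G} k_g·g = 0. -/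
open Finset

/-- Multiplying by a transposition splits a cycle. -/
lemma hall_split {G : Type*} [Fintype G] [DecidableEq G] (p : Equiv.Perm G) (u v : G)
    (huv : u ≠ v) (h : p.SameCycle u v) :
    ¬ (Equiv.swap u v * p).SameCycle u v := by
  intro hq
  have hex : ∃ k : ℕ, (p ^ k) u = v := h.exists_nat_pow_eq
  obtain ⟨n, hn⟩ := hq.exists_nat_pow_eq
  classical
  have hk := Nat.find_spec hex
  have hmin : ∀ i, i < Nat.find hex → (p ^ i) u ≠ v := fun i hi => Nat.find_min hex hi
  generalize Nat.find hex = k at hk hmin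
  have hkpos : 0 < k := by
    rcases Nat.eq_zero_or_pos k with h0 | h0
    · subst h0; exact absurd hk (by simpa using huv)
    · exact h0
  have main : ∀ n : ℕ, ∃ i, i < k ∧ ((Equiv.swap u v * p) ^ n) u = (p ^ i) u := by
    intro n
    induction n with
    | zero => exact ⟨0, hkpos, by simp⟩
    | succ n ih =>
      obtain ⟨i, hi, e⟩ := ih
      rw [pow_succ', Equiv.Perm.mul_apply, e, Equiv.Perm.mul_apply, ← Equiv.Perm.mul_apply p,
        ← pow_succ']
      rcases Nat.lt_or_ge (i + 1) k with h1 | h1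
      · refine ⟨i + 1, h1, Equiv.swap_apply_of_ne_of_ne ?_ (hmin _ h1)⟩
        intro hu
        apply hmin (k - (i + 1)) (by omega)
        rw [← hk]
        conv_rhs => rw [← Nat.sub_add_cancel h1.le, pow_add, Equiv.Perm.mul_apply, hu]
      · have : i + 1 = k := by omega
        exact ⟨0, hkpos, by rw [this, hk]; simp⟩
  obtain ⟨i, hi, e⟩ := main n
  exact hmin i hi (e ▸ hn)

/-- Exchange step when the two points lie on different cycles of `z ↦ π (z - K)`. -/
lemma hall_step_sep {G : Type*} [AddCommGroup G] [Fintype G] [DecidableEq G]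
    (π p : Equiv.Perm G) (a a' c c' K : G) (hK : K = π a' + π a - c)
    (hp : ∀ z, p z = π (z - K))
    (hs : c + c' = (a + π a) + (a' + π a'))
    (hsep : ¬ p.SameCycle (π a) (π a')) :
    ∃ (π' e : Equiv.Perm G), e a + π' (e a) = c ∧ e a' + π' (e a') = c' ∧
      ∀ g, g ≠ a → g ≠ a' → e g + π' (e g) = g + π g := by
  have hc' : c' = a + a' + K := by
    rw [hK, eq_sub_of_add_eq' hs]; abel
  set C := p.cycleOf (π a) with hC
  have hpa : p (a + K) = π a := by rw [hp]; simp
  have hpa' : p (a' + K) = π a' := by rw [hp]; simp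
  have hin : ∀ z, p.SameCycle (π a) z → C z = p z := fun z hz => hz.cycleOf_apply
  have hout : ∀ z, ¬ p.SameCycle (π a) z → C z = z := fun z hz =>
    Equiv.Perm.cycleOf_apply_of_not_sameCycle hz
  -- `p * C.symm` fixes the cycle pointwise
  have hrin : ∀ z, p.SameCycle (π a) z → p (C.symm z) = z := by
    intro z hz
    have h1 : p.SameCycle (π a) (p.symm z) := by
      rw [← Equiv.Perm.sameCycle_apply_right]; simpa using hz
    have h2 : C (p.symm z) = z := by rw [hin _ h1]; simp
    have h3 : C.symm z = p.symm z := by rw [Equiv.symm_apply_eq]; exact h2.symm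
    rw [h3]; simp
  have hrout : ∀ z, ¬ p.SameCycle (π a) z → p (C.symm z) = p z := by
    intro z hz
    have h3 : C.symm z = z := by rw [Equiv.symm_apply_eq]; exact (hout z hz).symm
    rw [h3]
  have hina : p.SameCycle (π a) (a + K) := by
    rw [← Equiv.Perm.sameCycle_apply_right, hpa]
  have houta : ¬ p.SameCycle (π a) (a' + K) := by
    rw [← Equiv.Perm.sameCycle_apply_right, hpa']; exact hsep
  refine ⟨(Equiv.addRight K).trans ((p * C.symm * C.symm).trans (Equiv.swap (π a') (a + K))),
    (Equiv.addRight K).trans (C.trans (Equiv.subRight K)), ?_, ?_, ?_⟩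
  · simp [hrin _ hina]
    rw [hin _ hina, hpa, hK]; abel
  · simp [hrout _ houta, hpa']
    rw [hout _ houta, hc']; abel
  · intro g hg hg'
    have hpg : p (g + K) = π g := by rw [hp]; simp
    by_cases h : p.SameCycle (π a) (g + K)
    · have h1 : g + K ≠ π a' := fun e => hsep (e ▸ h)
      have h2 : g + K ≠ a + K := fun e => hg (add_right_cancel e)
      simp [hrin _ h]
      rw [Equiv.swap_apply_of_ne_of_ne h1 h2, hin _ h, hpg]; abel
    · have h1 : π g ≠ π a' := fun e => hg' (π.injective e)
      have h2 : π g ≠ a + K := by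
        intro e
        apply h
        rw [← Equiv.Perm.sameCycle_apply_right, hpg, e]; exact hina
      simp [hrout _ h, hpg]
      rw [Equiv.swap_apply_of_ne_of_ne h1 h2, hout _ h]; abel

/-- Exchange step, pointwise form. -/
lemma hall_step_pt {G : Type*} [AddCommGroup G] [Fintype G] [DecidableEq G]
    (π : Equiv.Perm G) (a a' c c' : G) (haa : a ≠ a')
    (hs : c + c' = (a + π a) + (a' + π a')) :
    ∃ (π' e : Equiv.Perm G), ({e a + π' (e a), e a' + π' (e a')} : Multiset G) = {c, c'} ∧
      ∀ g, g ≠ a → g ≠ a' → e g + π' (e g) = g + π g := by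
  set K := π a' + π a - c with hK
  set p : Equiv.Perm G := (Equiv.subRight K).trans π with hp
  by_cases hsep : p.SameCycle (π a) (π a')
  · set π₁ : Equiv.Perm G := (Equiv.swap a a').trans π with hπ₁
    have h1 : π₁ a = π a' := by simp [hπ₁]
    have h2 : π₁ a' = π a := by simp [hπ₁]
    have hsep' : ¬ Equiv.Perm.SameCycle ((Equiv.subRight K).trans π₁) (π₁ a) (π₁ a') := by
      have : ((Equiv.subRight K).trans π₁ : Equiv.Perm G) = Equiv.swap (π a) (π a') * p := by
        ext z
        simp only [hπ₁, hp, Equiv.trans_apply, Equiv.Perm.mul_apply]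
        rw [π.injective.swap_apply]
      rw [this, h1, h2]
      exact fun hh => hall_split p _ _ (fun h => haa (π.injective h)) hsep hh.symm
    obtain ⟨π', e, e1, e2, e3⟩ := hall_step_sep π₁ ((Equiv.subRight K).trans π₁) a a' c c' K
      (by rw [h1, h2, hK]; abel) (fun z => by simp) (by rw [h1, h2, hs]; abel) hsep'
    refine ⟨π', e, by rw [e1, e2], fun g hg hg' => ?_⟩
    rw [e3 g hg hg', hπ₁, Equiv.trans_apply, Equiv.swap_apply_of_ne_of_ne hg hg']
  · obtain ⟨π', e, e1, e2, e3⟩ := hall_step_sep π p a a' c c' K hK (fun z => by simp [hp]) hs hsep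
    exact ⟨π', e, by rw [e1, e2], e3⟩

lemma hall_step {G : Type*} [AddCommGroup G] [Fintype G]
    (π : Equiv.Perm G) (d d' c c' : G) (R : Multiset G)
    (h : Multiset.map (fun g => g + π g) Finset.univ.val = d ::ₘ d' ::ₘ R)
    (hs : c + c' = d + d') :
    ∃ π' : Equiv.Perm G,
      Multiset.map (fun g => g + π' g) Finset.univ.val = c ::ₘ c' ::ₘ R := by
  classical
  have hd : d ∈ Multiset.map (fun g => g + π g) Finset.univ.val := by rw [h]; simp
  obtain ⟨a, ha, rfl⟩ := Multiset.mem_map.1 hd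
  obtain ⟨s, hsu⟩ := Multiset.exists_cons_of_mem ha
  have hnd : (a ::ₘ s).Nodup := hsu ▸ Finset.univ.nodup
  rw [hsu, Multiset.map_cons, Multiset.cons_inj_right] at h
  have hd : d' ∈ Multiset.map (fun g => g + π g) s := by rw [h]; simp
  obtain ⟨a', ha', rfl⟩ := Multiset.mem_map.1 hd
  obtain ⟨t, rfl⟩ := Multiset.exists_cons_of_mem ha'
  rw [Multiset.map_cons, Multiset.cons_inj_right] at h
  simp only [Multiset.nodup_cons, Multiset.mem_cons, not_or] at hnd
  obtain ⟨⟨n1, n2⟩, n3, -⟩ := hnd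
  obtain ⟨π', e, h1, h2⟩ := hall_step_pt π a a' c c' n1 hs
  refine ⟨π', ?_⟩
  have key : Multiset.map (fun g => g + π' g) Finset.univ.val
      = Multiset.map (fun g => e g + π' (e g)) Finset.univ.val := by
    have : (Finset.univ.val : Multiset G) = Multiset.map e Finset.univ.val := by
      have := congrArg Finset.val (Finset.map_univ_equiv e)
      simpa using this.symm
    conv_lhs => rw [this]
    rw [Multiset.map_map]; rfl
  have ht : Multiset.map (fun g => e g + π' (e g)) t = R := by
    rw [← h]
    apply Multiset.map_congr rfl
    intro g hg
    exact h2 g (fun e => n2 (e ▸ hg)) (fun e => n3 (e ▸ hg))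
  rw [key, hsu, Multiset.map_cons, Multiset.map_cons, ht]
  have := congrArg (· + R) h1
  simpa [Multiset.insert_eq_cons] using this

lemma hall_exists {G : Type*} [AddCommGroup G] [Fintype G] (A : Multiset G) :
    ∀ k : ℕ, Multiset.card A + k + 1 = Fintype.card G →
    ∃ π : Equiv.Perm G, Multiset.map (fun g => g + π g) Finset.univ.val
      = (-A.sum) ::ₘ (A + Multiset.replicate k 0) := by
  induction A using Multiset.induction with
  | empty =>
    intro k hk
    refine ⟨Equiv.neg G, ?_⟩
    have : Fintype.card G = k + 1 := by simp at hk; omega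
    simp [this, Multiset.replicate_succ]
  | cons a A ih =>
    intro k hk
    obtain ⟨π, hπ⟩ := ih (k + 1) (by simp at hk; omega)
    rw [Multiset.replicate_succ, Multiset.add_cons] at hπ
    obtain ⟨π', h'⟩ := hall_step π _ _ (-(a ::ₘ A).sum) a _ hπ (by simp)
    exact ⟨π', by rw [h']; simp⟩

/-- M. Hall's theorem: for a finite abelian group `G` of order `n` and a multiset `M` of
elements of `G` with `card M = n`, there exists a bijection `π : G → G` with
`M = {g + π(g) : g ∈ G}` (as multisets) if and only if the sum of the elements of `M`
equals `0`.  Equivalently, a monomial `∏ x_g^{k_g}` of degree `n` occurs in the permanent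
of the Cayley table of `G` iff `Σ k_g·g = 0`. -/
theorem hall_cayley_permanent_monomials (G : Type*) [AddCommGroup G] [Fintype G]
    (M : Multiset G) (hM : Multiset.card M = Fintype.card G) :
    (∃ π : Equiv.Perm G, M = Multiset.map (fun g => g + π g) Finset.univ.val) ↔
      M.sum = 0 := by
  constructor
  · rintro ⟨π, rfl⟩
    change ∑ g, (g + π g) = 0
    rw [Finset.sum_add_distrib, Equiv.sum_comp π (fun g => g),
      add_eq_zero_iff_eq_neg, ← Finset.sum_neg_distrib]
    exact (Equiv.sum_comp (Equiv.neg G) (fun g => g)).symm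
  · intro h0
    have hpos : 0 < Multiset.card M := by rw [hM]; exact Fintype.card_pos
    obtain ⟨a, ha⟩ := Multiset.card_pos_iff_exists_mem.1 hpos
    obtain ⟨A, rfl⟩ := Multiset.exists_cons_of_mem ha
    obtain ⟨π, hπ⟩ := hall_exists A 0 (by simpa using hM)
    refine ⟨π, ?_⟩
    rw [hπ]
    have : a = -A.sum := eq_neg_of_add_eq_zero_left (by simpa using h0)
    simp [this]
end

section
/- Let G be a finite abelian group, written additively, of order n, and let per(M_G) = Σ_{π ∈ Perm(G)} ∏_{g∈G} x_{g+π(g)} be the permanent of the Cayley table of G, an element of the polynomial ring ℂ[x_g : g ∈ G]. Then the number of monomials occurring with nonzero coefficient in per(M_G) equals the dimension over ℂ of the space of G-invariant homogeneous polynomials of degree n in ℂ[x_g : g ∈ G], where G acts by γ · x_g = x_{g+γ}. -/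
open Finset MvPolynomial

theorem not_sameCycle_or {α : Type*} [Finite α] [DecidableEq α] (τ : Equiv.Perm α) (x y : α)
    (hxy : x ≠ y) : ¬ τ.SameCycle x y ∨ ¬ (Equiv.swap x y * τ).SameCycle x y := by
  by_cases h : τ.SameCycle x y
  swap
  · exact Or.inl h
  right
  have hex : ∃ m : ℕ, (τ ^ m) x = y := by
    obtain ⟨i, -, hi⟩ := h.exists_pow_eq'
    exact ⟨i, hi⟩
  classical
  obtain ⟨m, hm, hmin⟩ : ∃ m : ℕ, (τ ^ m) x = y ∧ ∀ k < m, (τ ^ k) x ≠ y :=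
    ⟨Nat.find hex, Nat.find_spec hex, fun k hk => Nat.find_min hex hk⟩
  have hx : ∀ k, 0 < k → k < m → (τ ^ k) x ≠ x := by
    intro k hk hkm hkx
    apply hmin (m - k) (by omega)
    have : (τ ^ (m - k)) ((τ ^ k) x) = y := by
      rw [← Equiv.Perm.mul_apply, ← pow_add, Nat.sub_add_cancel hkm.le, hm]
    rwa [hkx] at this
  have hm0 : 0 < m := by
    rcases Nat.eq_zero_or_pos m with h0 | h0
    · subst h0; exact absurd hm (by simpa using hxy)
    · exact h0
  have key : ∀ j : ℕ, ∃ k < m, ((Equiv.swap x y * τ) ^ j) x = (τ ^ k) x := by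
    intro j
    induction j with
    | zero => exact ⟨0, hm0, by simp⟩
    | succ j ih =>
      obtain ⟨k, hk, hkj⟩ := ih
      rw [pow_succ', Equiv.Perm.mul_apply, hkj, Equiv.Perm.mul_apply, ← Equiv.Perm.mul_apply τ,
        ← pow_succ']
      rcases Nat.lt_or_ge (k + 1) m with hlt | hge
      · exact ⟨k + 1, hlt, Equiv.swap_apply_of_ne_of_ne (hx _ (by omega) hlt) (hmin _ hlt)⟩
      · have : k + 1 = m := by omega
        rw [this, hm]
        exact ⟨0, hm0, by simp⟩
  intro hs
  obtain ⟨i, -, hi⟩ := hs.exists_pow_eq'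
  obtain ⟨k, hk, hkj⟩ := key i
  exact hmin k hk (hkj.symm.trans hi)

theorem hall_core {G : Type*} [AddCommGroup G] [Fintype G] [DecidableEq G]
    (a : G → G) (i j : G) (hij : i ≠ j) (φ θ : Equiv.Perm G)
    (h : ∀ k, k ≠ i → k ≠ j → a k = φ k - θ k)
    (hs : a i + a j = φ i - θ i + (φ j - θ j))
    (τ : Equiv.Perm G) (hτ : ∀ u, τ (φ i + φ j - a j - φ u) = θ u)
    (hc : ¬ τ.SameCycle (θ j) (θ i)) :
    ∃ φ' θ' : Equiv.Perm G, ∀ k, a k = φ' k - θ' k := by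
  classical
  have hτ' : ∀ u, φ (θ.symm (τ u)) = φ i + φ j - a j - u := by
    intro u
    obtain ⟨v, hv⟩ : ∃ v, φ i + φ j - a j - φ v = u :=
      ⟨φ.symm (φ i + φ j - a j - u), by simp⟩
    rw [← hv, hτ]; simp
  have hτi : ∀ u, τ.symm (θ u) = φ i + φ j - a j - φ u := by
    intro u; rw [← hτ]; simp
  set κ := τ.cycleOf (θ j) with hκ
  have hκ1 : ∀ u, τ.SameCycle (θ j) u → κ u = τ u := fun u hu => hu.cycleOf_apply
  have hκ2 : ∀ u, ¬ τ.SameCycle (θ j) u → κ u = u :=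
    fun u hu => Equiv.Perm.cycleOf_apply_of_not_sameCycle hu
  have hκ3 : ∀ u, τ.SameCycle (θ j) u → κ.symm u = τ.symm u := by
    intro u hu
    rw [Equiv.symm_apply_eq, hκ1]
    · simp
    · rw [← Equiv.Perm.sameCycle_apply_right]
      simpa using hu
  have hκ4 : ∀ u, ¬ τ.SameCycle (θ j) u → κ.symm u = u := by
    intro u hu
    rw [Equiv.symm_apply_eq, hκ2 _ hu]
  refine ⟨((Equiv.swap i j).trans θ).trans (κ.trans (θ.symm.trans φ)), θ.trans κ.symm, fun k => ?_⟩
  simp only [Equiv.trans_apply]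
  by_cases hki : k = i
  · subst hki
    rw [Equiv.swap_apply_left, hκ1 _ (Equiv.Perm.SameCycle.refl _ _), hτ', hκ4 _ hc]
    rw [eq_sub_of_add_eq hs]; abel
  by_cases hkj : k = j
  · subst hkj
    rw [Equiv.swap_apply_right, hκ2 _ hc, hκ3 _ (Equiv.Perm.SameCycle.refl _ _), hτi, Equiv.symm_apply_apply]
    abel
  rw [Equiv.swap_apply_of_ne_of_ne hki hkj]
  by_cases hk : τ.SameCycle (θ j) (θ k)
  · rw [hκ1 _ hk, hκ3 _ hk, hτ', hτi, h k hki hkj]; abel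
  · rw [hκ2 _ hk, hκ4 _ hk, h k hki hkj]; simp

theorem hall_step_s13 {G : Type*} [AddCommGroup G] [Fintype G] [DecidableEq G]
    (a : G → G) (i j : G) (hij : i ≠ j) (φ θ : Equiv.Perm G)
    (h : ∀ k, k ≠ i → k ≠ j → a k = φ k - θ k)
    (hs : a i + a j = φ i - θ i + (φ j - θ j)) :
    ∃ φ' θ' : Equiv.Perm G, ∀ k, a k = φ' k - θ' k := by
  set c := φ i + φ j - a j with hcdef
  set τ : Equiv.Perm G := (Equiv.subLeft c).trans (φ.symm.trans θ) with hτ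
  have hτ1 : ∀ u, τ (φ i + φ j - a j - φ u) = θ u := by
    intro u; simp [hτ, ← hcdef]
  rcases not_sameCycle_or τ (θ j) (θ i) (by simpa using hij.symm) with hc | hc
  · exact hall_core a i j hij φ θ h hs τ hτ1 hc
  · refine hall_core a i j hij ((Equiv.swap i j).trans φ) θ ?_ ?_ _ ?_ hc
    · intro k h1 h2
      simp [Equiv.swap_apply_of_ne_of_ne h1 h2, h k h1 h2]
    · simp [hs]; abel
    · intro u
      simp only [Equiv.trans_apply, Equiv.swap_apply_left, Equiv.swap_apply_right,
        Equiv.Perm.mul_apply]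
      rw [add_comm (φ j), hτ1]
      rw [← Function.Injective.map_swap θ.injective, Equiv.swap_comm, Equiv.swap_apply_self]

theorem hall {G : Type*} [AddCommGroup G] [Fintype G] [DecidableEq G] (N : ℕ) :
    ∀ b : G → G, (univ.filter fun k => b k ≠ 0).card ≤ N → ∑ k, b k = 0 →
    ∃ φ θ : Equiv.Perm G, ∀ k, b k = φ k - θ k := by
  induction N with
  | zero =>
    intro b hb _
    refine ⟨1, 1, fun k => ?_⟩
    have : (univ.filter fun k => b k ≠ 0) = ∅ := by simpa using hb
    simpa using (Finset.filter_eq_empty_iff.1 this (mem_univ k))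
  | succ N ih =>
    intro b hb hsum
    by_cases h0 : ∀ k, b k = 0
    · exact ⟨1, 1, by simpa using h0⟩
    push Not at h0
    obtain ⟨i, hi⟩ := h0
    obtain ⟨j, hji, hj⟩ : ∃ j, j ≠ i ∧ b j ≠ 0 := by
      by_contra! hcon
      apply hi
      rw [← hsum, Finset.sum_eq_single i (fun k _ hk => hcon k hk) (by simp)]
    set b' := Function.update (Function.update b i 0) j (b i + b j) with hb'
    have b'i : b' i = 0 := by simp [hb', hji.symm]
    have b'j : b' j = b i + b j := by simp [hb']
    have b'k : ∀ k, k ≠ i → k ≠ j → b' k = b k := by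
      intro k h1 h2; simp [hb', h1, h2]
    have hcard : (univ.filter fun k => b' k ≠ 0).card ≤ N := by
      refine Nat.lt_succ_iff.1 (lt_of_lt_of_le (Finset.card_lt_card ?_) hb)
      rw [Finset.ssubset_iff_of_subset]
      · exact ⟨i, by simp [hi], by simp [b'i]⟩
      · intro k
        simp only [mem_filter, mem_univ, true_and]
        intro hk
        by_cases h1 : k = i
        · rwa [h1]
        by_cases h2 : k = j
        · rwa [h2]
        rwa [b'k k h1 h2] at hk
    have hsum' : ∑ k, b' k = 0 := by
      rw [← hsum, ← sub_eq_zero, ← Finset.sum_sub_distrib, 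
        Fintype.sum_eq_add i j hji.symm (fun k hk => by rw [b'k k hk.1 hk.2, sub_self]), b'i, b'j]
      abel
    obtain ⟨φ, θ, h⟩ := ih b' hcard hsum'
    refine hall_step_s13 b i j hji.symm φ θ (fun k h1 h2 => ?_) ?_
    · rw [← h, b'k k h1 h2]
    · rw [← h, ← h, b'i, b'j, zero_add]


/-- exponents of degree `card G` with weighted sum zero -/
noncomputable def zeroSumExps (G : Type*) [AddCommGroup G] [Fintype G] [DecidableEq G] :
    Finset (G →₀ ℕ) :=
  (finsuppAntidiag (univ : Finset G) (Fintype.card G)).filter fun m => ∑ g, m g • g = 0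

theorem mem_zeroSumExps {G : Type*} [AddCommGroup G] [Fintype G] [DecidableEq G] (m : G →₀ ℕ) :
    m ∈ zeroSumExps G ↔ ∑ g, m g = Fintype.card G ∧ ∑ g, m g • g = 0 := by
  simp [zeroSumExps, mem_finsuppAntidiag]

theorem exists_fun_of_exp {G : Type*} [Fintype G] [DecidableEq G]
    (m : G →₀ ℕ) (hm : ∑ g, m g = Fintype.card G) :
    ∃ b : G → G, ∑ g, Finsupp.single (b g) 1 = m := by
  have hc : (Finsupp.toMultiset m).card = Fintype.card G := by
    rw [Finsupp.card_toMultiset, ← hm, Finsupp.sum_fintype _ _ (by simp)]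
    simp
  obtain ⟨l, hl⟩ : ∃ l : List G, (l : Multiset G) = Finsupp.toMultiset m :=
    ⟨_, Multiset.coe_toList _⟩
  have hlen : l.length = Fintype.card G := by rw [← hc, ← hl]; simp
  let e : G ≃ Fin l.length := Fintype.equivOfCardEq (by simp [hlen])
  refine ⟨fun g => l.get (e g), ?_⟩
  rw [Equiv.sum_comp e (fun k => Finsupp.single (l.get k) 1)]
  apply Multiset.toFinsupp.symm.injective
  change Finsupp.toMultiset _ = Finsupp.toMultiset _
  rw [map_sum, ← hl]
  simp only [Finsupp.toMultiset_single, one_smul]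
  have h2 : ∀ l : List G, ∑ k : Fin l.length, ({l.get k} : Multiset G) = (l : Multiset G) := by
    intro l
    induction l with
    | nil => simp
    | cons a l ih =>
      refine (Fin.sum_univ_succ (n := l.length) _).trans ?_
      have := ih
      simp only [List.get_eq_getElem] at this
      simp [this]
  exact h2 l

theorem support_perm {G : Type*} [AddCommGroup G] [Fintype G] [DecidableEq G]
    (hall : ∀ b : G → G, ∑ k, b k = 0 → ∃ φ θ : Equiv.Perm G, ∀ k, b k = φ k - θ k) :
    (∑ π : Equiv.Perm G, ∏ g : G, (X (g + π g) : MvPolynomial G ℂ)).support = zeroSumExps G := by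
  have hmon : ∀ π : Equiv.Perm G, ∏ g : G, (X (g + π g) : MvPolynomial G ℂ) =
      monomial (∑ g, Finsupp.single (g + π g) 1) 1 := by
    intro π
    rw [monomial_sum_one]; rfl
  ext m
  rw [mem_support_iff, coeff_sum]
  simp only [hmon, coeff_monomial]
  rw [Finset.sum_boole, Nat.cast_ne_zero, Finset.card_ne_zero, mem_zeroSumExps]
  constructor
  · rintro ⟨π, hπ⟩
    simp only [mem_filter, mem_univ, true_and] at hπ
    subst hπ
    constructor
    · simp only [Finsupp.finsetSum_apply]
      rw [Finset.sum_comm]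
      simp [Finsupp.single_apply]
    · simp only [Finsupp.finsetSum_apply, Finset.sum_smul]
      rw [Finset.sum_comm]
      simp only [Finsupp.single_apply, ite_smul, one_smul, zero_smul, Finset.sum_ite_eq,
        mem_univ, if_true]
      rw [Finset.sum_add_distrib, Equiv.sum_comp π (fun g => g)]
      nth_rewrite 2 [← Equiv.sum_comp (Equiv.neg G) (fun g => g)]
      rw [← Finset.sum_add_distrib]
      simp
  · rintro ⟨h1, h2⟩
    obtain ⟨b, hb⟩ := exists_fun_of_exp m h1
    have hb0 : ∑ g, b g = 0 := by
      rw [← h2, ← hb]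
      simp only [Finsupp.finsetSum_apply, Finset.sum_smul]
      rw [Finset.sum_comm]
      simp only [Finsupp.single_apply, ite_smul, one_smul, zero_smul, Finset.sum_ite_eq,
        mem_univ, if_true]
    obtain ⟨φ, θ, h⟩ := hall b hb0
    -- reindex by g = -θ k
    let e : Equiv.Perm G := θ.trans (Equiv.neg G)
    refine ⟨e.symm.trans φ, ?_⟩
    simp only [mem_filter, mem_univ, true_and]
    rw [← hb, ← Equiv.sum_comp e]
    refine Finset.sum_congr rfl fun k _ => ?_
    rw [h k]
    congr 1
    simp [e, sub_eq_neg_add]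

section dual
variable {G : Type*} [AddCommGroup G] [Fintype G] [DecidableEq G]

theorem exists_pairing (G : Type*) [AddCommGroup G] [Fintype G] :
    ∃ B : G → G → ℂˣ, (∀ h g g', B h (g + g') = B h g * B h g') ∧
      (∀ h h' g, B (h + h') g = B h g * B h' g) ∧
      (∀ h, (∀ g, B h g = 1) → h = 0) ∧
      (∀ h, h ≠ 0 → ∑ g, (B h g : ℂ) = 0) := by
  classical
  obtain ⟨e⟩ := CommGroup.monoidHom_mulEquiv_of_hasEnoughRootsOfUnity (Multiplicative G) ℂ
  have h3 : ∀ h : G, (∀ g : G, e.symm (Multiplicative.ofAdd h) (Multiplicative.ofAdd g) = 1) →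
      h = 0 := by
    intro h hh
    have : e.symm (Multiplicative.ofAdd h) = 1 := by
      refine MonoidHom.ext fun g => ?_
      exact hh g.toAdd
    simpa using this
  refine ⟨fun h g => e.symm (Multiplicative.ofAdd h) (Multiplicative.ofAdd g), ?_, ?_, h3, ?_⟩
  · intros; simp
  · intros; simp
  · intro h hh
    have := sum_hom_units_eq_zero ((Units.coeHom ℂ).comp (e.symm (Multiplicative.ofAdd h))) (by
      intro h1
      apply hh
      apply h3
      intro g
      have := DFunLike.congr_fun h1 (Multiplicative.ofAdd g)
      simpa using this)
    rw [← this]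
    exact Fintype.sum_equiv Multiplicative.ofAdd _ _ (fun _ => rfl)

theorem linSub_comp (F F' : Matrix G G ℂ) (h : F * F' = 1) :
    (aeval (fun i => ∑ j, C (F' i j) * X j : G → MvPolynomial G ℂ)).comp
      (aeval (fun i => ∑ j, C (F i j) * X j : G → MvPolynomial G ℂ)) = AlgHom.id ℂ _ := by
  ext1 i
  simp only [AlgHom.comp_apply, aeval_X, map_sum, map_mul, algHom_C, AlgHom.id_apply,
    algebraMap_eq, Finset.mul_sum]
  rw [Finset.sum_comm]
  simp only [← mul_assoc, ← C_mul, ← Finset.sum_mul, ← map_sum, ← Matrix.mul_apply, h]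
  simp [Matrix.one_apply]

theorem linSub_homog (F : Matrix G G ℂ) (p : MvPolynomial G ℂ) (n : ℕ) (hp : p.IsHomogeneous n) :
    (aeval (fun i => ∑ j, C (F i j) * X j : G → MvPolynomial G ℂ) p).IsHomogeneous n := by
  have := hp.aeval (fun i => ∑ j, C (F i j) * X j : G → MvPolynomial G ℂ) (n := 1) (fun i => by
    apply IsHomogeneous.sum
    intro j _
    exact isHomogeneous_C_mul_X _ _)
  simpa using this

theorem coeff_diag (d : G → ℂ) (p : MvPolynomial G ℂ) (m : G →₀ ℕ) :
    coeff m (aeval (fun i => C (d i) * X i : G → MvPolynomial G ℂ) p) =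
      (∏ i, d i ^ m i) * coeff m p := by
  induction p using MvPolynomial.induction_on' with
  | add p q hp hq => rw [map_add, coeff_add, coeff_add, hp, hq, mul_add]
  | monomial u a =>
    rw [aeval_monomial, Finsupp.prod_fintype _ _ (by simp)]
    simp only [mul_pow, Finset.prod_mul_distrib, ← C_pow, ← map_prod, algebraMap_eq]
    have : ∏ i, (X i : MvPolynomial G ℂ) ^ u i = monomial u 1 := by
      rw [monomial_eq, Finsupp.prod_fintype _ _ (by simp)]; simp
    rw [this, coeff_C_mul, coeff_C_mul, coeff_monomial, coeff_monomial]
    split_ifs with h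
    · subst h; ring
    · simp

theorem finrank_inv (G : Type*) [AddCommGroup G] [Fintype G] [DecidableEq G] :
    Module.finrank ℂ
      ↥(homogeneousSubmodule G ℂ (Fintype.card G) ⊓
        ⨅ γ : G, LinearMap.eqLocus
          (rename (fun g => g + γ) : MvPolynomial G ℂ →ₐ[ℂ] MvPolynomial G ℂ).toLinearMap
          LinearMap.id) = (zeroSumExps G).card := by
  obtain ⟨B, B1, B2, B3, B4⟩ := exists_pairing G
  have hn : (Fintype.card G : ℂ) ≠ 0 := by simp
  have B0 : ∀ g, B 0 g = 1 := by
    intro g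
    have := B2 0 0 g
    simpa using this
  let F : Matrix G G ℂ := fun h g => B h g
  let F' : Matrix G G ℂ := fun g h => (Fintype.card G : ℂ)⁻¹ * B (-h) g
  have hFF' : F * F' = 1 := by
    ext h h'
    rw [Matrix.mul_apply]
    have : ∀ g, F h g * F' g h' = (Fintype.card G : ℂ)⁻¹ * (B (h - h') g : ℂ) := by
      intro g
      simp only [F, F', sub_eq_add_neg, B2, Units.val_mul]
      ring
    simp only [this, ← Finset.mul_sum]
    by_cases hh : h = h'
    · subst hh
      simp [B0]
    · rw [B4 _ (sub_ne_zero.2 hh)]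
      simp [Matrix.one_apply, hh]
  have hF'F : F' * F = 1 := mul_eq_one_comm.1 hFF'
  let Φ : MvPolynomial G ℂ ≃ₐ[ℂ] MvPolynomial G ℂ :=
    AlgEquiv.ofAlgHom (aeval (fun i => ∑ j, C (F i j) * X j))
      (aeval (fun i => ∑ j, C (F' i j) * X j)) (linSub_comp _ _ hF'F) (linSub_comp _ _ hFF')
  have hhom : ∀ p n, (Φ p).IsHomogeneous n ↔ p.IsHomogeneous n := by
    intro p n
    constructor
    · intro h
      have := linSub_homog F' _ n h
      have h2 : Φ.symm (Φ p) = p := Φ.symm_apply_apply p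
      rw [← h2]; exact this
    · exact linSub_homog F p n
  have hact : ∀ γ p, rename (fun g => g + γ) (Φ p) =
      Φ (aeval (fun i => C ((B i (-γ) : ℂˣ) : ℂ) * X i : G → MvPolynomial G ℂ) p) := by
    intro γ p
    have : (rename (fun g => g + γ)).comp (Φ : MvPolynomial G ℂ →ₐ[ℂ] MvPolynomial G ℂ) =
      (Φ : MvPolynomial G ℂ →ₐ[ℂ] MvPolynomial G ℂ).comp
       (aeval (fun i => C ((B i (-γ) : ℂˣ) : ℂ) * X i : G → MvPolynomial G ℂ)) := by
      ext1 i
      have hX : Φ (X i) = ∑ j, C (F i j) * X j := aeval_X _ _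
      have hC : ∀ a, Φ (C a) = C a := fun a => Φ.commutes a
      simp only [AlgHom.comp_apply, AlgEquiv.coe_toAlgHom, aeval_X, map_mul, hX, hC, map_sum,
        rename_C, rename_X, Finset.mul_sum]
      rw [← Equiv.sum_comp (Equiv.addRight γ)
        (fun j => C ((B i (-γ) : ℂˣ) : ℂ) * (C (F i j) * X j : MvPolynomial G ℂ))]
      refine Finset.sum_congr rfl fun j _ => ?_
      rw [← mul_assoc, ← C_mul]
      congr 2
      simp only [F, Equiv.coe_addRight, ← Units.val_mul, ← B1]
      congr 2
      abel
    exact DFunLike.congr_fun this p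
  have hB : ∀ (m : G →₀ ℕ) (γ : G), ∏ i, ((B i γ : ℂˣ) : ℂ) ^ m i = B (∑ i, m i • i) γ := by
    intro m γ
    let f : Multiplicative G →* ℂˣ :=
      { toFun := fun h => B h.toAdd γ
        map_one' := B0 γ
        map_mul' := fun a b => B2 _ _ _ }
    have : f (∏ i, Multiplicative.ofAdd i ^ m i) = ∏ i, f (Multiplicative.ofAdd i) ^ m i := by
      simp
    have h2 : (∏ i : G, Multiplicative.ofAdd i ^ m i) = Multiplicative.ofAdd (∑ i, m i • i) := by
      simp
    rw [h2] at this
    have h3 := congrArg (Units.val) this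
    simp only [Units.coe_prod, Units.val_pow_eq_pow_val] at h3
    exact h3.symm
  have hmem : restrictSupport ℂ (zeroSumExps G : Set (G →₀ ℕ)) =
     (homogeneousSubmodule G ℂ (Fintype.card G) ⊓
        ⨅ γ : G, LinearMap.eqLocus
          (rename (fun g => g + γ) : MvPolynomial G ℂ →ₐ[ℂ] MvPolynomial G ℂ).toLinearMap
          LinearMap.id).comap Φ.toLinearEquiv.toLinearMap := by
    ext p
    rw [mem_restrictSupport_iff, Submodule.mem_comap, Submodule.mem_inf, Submodule.mem_iInf,
      mem_homogeneousSubmodule]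
    simp only [LinearMap.mem_eqLocus, AlgHom.toLinearMap_apply, LinearMap.id_apply]
    change _ ↔ (Φ p).IsHomogeneous _ ∧ ∀ γ, rename (fun g => g + γ) (Φ p) = Φ p
    simp only [hhom, hact, Φ.injective.eq_iff, MvPolynomial.ext_iff, coeff_diag, hB]
    have hdeg : ∀ m : G →₀ ℕ, Finsupp.weight (1 : G → ℕ) m = ∑ g, m g := by
      intro m
      rw [Finsupp.weight_apply, Finsupp.sum_fintype _ _ (by simp)]
      simp
    constructor
    · intro h
      refine ⟨fun m hm => ?_, fun γ m => ?_⟩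
      · rw [hdeg]
        exact ((mem_zeroSumExps m).1 (h (mem_support_iff.2 hm))).1
      · by_cases hm : coeff m p = 0
        · simp [hm]
        · rw [((mem_zeroSumExps m).1 (h (mem_support_iff.2 hm))).2, B0]
          simp
    · rintro ⟨h1, h2⟩ m hm
      have hm' := mem_support_iff.1 hm
      refine (mem_zeroSumExps m).2 ⟨by rw [← hdeg]; exact h1 hm', B3 _ fun g => ?_⟩
      have := h2 (-g) m
      rw [neg_neg] at this
      have := mul_right_cancel₀ hm' (this.trans (one_mul _).symm)
      exact Units.ext this
  have e1 := (Φ.toLinearEquiv.submoduleMap (restrictSupport ℂ (zeroSumExps G : Set (G →₀ ℕ))))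
  rw [hmem, Submodule.map_comap_eq_of_surjective Φ.toLinearEquiv.surjective] at e1
  rw [← e1.finrank_eq, ← hmem, Module.finrank_eq_nat_card_basis (basisRestrictSupport ℂ _)]
  simp

end dual

/-- The number of monomials occurring (with nonzero coefficient) in the permanent of the
Cayley table of a finite abelian group `G` of order `n` equals the dimension of the space
of `G`-invariant homogeneous polynomials of degree `n` in `ℂ[x_g : g ∈ G]`, where `G`
acts by `γ · x_g = x_{g+γ}`. -/
theorem card_permanent_monomials_eq_finrank_invariants
    (G : Type*) [AddCommGroup G] [Fintype G] [DecidableEq G] :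
    (∑ π : Equiv.Perm G, ∏ g : G, (X (g + π g) : MvPolynomial G ℂ)).support.card =
    Module.finrank ℂ
      ↥(homogeneousSubmodule G ℂ (Fintype.card G) ⊓
        ⨅ γ : G, LinearMap.eqLocus
          (rename (fun g => g + γ) : MvPolynomial G ℂ →ₐ[ℂ] MvPolynomial G ℂ).toLinearMap
          LinearMap.id) := by
  rw [support_perm (fun b hb => hall _ b le_rfl hb), finrank_inv]
end

section
/- Let G be a finite abelian group, written additively, of order n. Let I = G ⊔ {∗} be the index set with n+1 elements and define x : I → G by x(g) = g for g ∈ G and x(∗) = 0 (so the value 0 is taken twice, by the index 0 ∈ G and by ∗). Let M be a multiset of elements of G with card(M) = n+1. Then there exists a bijection π : I → I such that M equals the multiset {x(i) + x(π(i)) : i ∈ I} if and only if the sum of the elements of M (with multiplicity) equals 0 in G. Consequently, a monomial ∏_{g∈G} x_g^{k_g} of total degree n+1 occurs in the permanent of the extended Cayley table of G if and only if Σ_{g∈G} k_g·g = 0. -/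
open Finset

namespace ExtCayley

/-- The multiset of sums attached to a permutation. -/
def F {I G : Type*} [AddCommGroup G] [Fintype I] (x : I → G) (σ : Equiv.Perm I) : Multiset G :=
  Multiset.map (fun i => x i + x (σ i)) Finset.univ.val

lemma univ_split {I : Type*} [Fintype I] {a b : I} (h : a ≠ b) :
    ∃ R : Multiset I, (Finset.univ : Finset I).val = a ::ₘ b ::ₘ R ∧ a ∉ R ∧ b ∉ R := by
  classical
  obtain ⟨S, hS⟩ := Multiset.exists_cons_of_mem (Finset.mem_univ_val a)
  have hb : b ∈ S := by
    have : b ∈ a ::ₘ S := hS ▸ Finset.mem_univ_val b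
    rcases Multiset.mem_cons.1 this with h' | h'
    · exact absurd h'.symm h
    · exact h'
  obtain ⟨R, hR⟩ := Multiset.exists_cons_of_mem hb
  have nd : (a ::ₘ b ::ₘ R).Nodup := by
    rw [← hR, ← hS]; exact Finset.univ.nodup
  rw [Multiset.nodup_cons, Multiset.nodup_cons, Multiset.mem_cons] at nd
  refine ⟨R, by rw [hS, hR], fun h => nd.1 (Or.inr h), nd.2.1⟩

lemma F_swap {I G : Type*} [AddCommGroup G] [Fintype I] [DecidableEq I] (x : I → G)
    (σ : Equiv.Perm I) {a b : I} (h : a ≠ b) (N : Multiset G)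
    (hN : F x σ = (x a + x (σ a)) ::ₘ (x b + x (σ b)) ::ₘ N) :
    F x (σ * Equiv.swap a b) = (x a + x (σ b)) ::ₘ (x b + x (σ a)) ::ₘ N := by
  obtain ⟨R, hR, ha, hb⟩ := univ_split h
  unfold F at hN ⊢
  rw [hR] at hN ⊢
  simp only [Multiset.map_cons, Multiset.cons_inj_right] at hN
  simp only [Multiset.map_cons, Equiv.Perm.mul_apply, Equiv.swap_apply_left,
    Equiv.swap_apply_right, Multiset.cons_inj_right]
  rw [← hN]
  apply Multiset.map_congr rfl
  intro i hi
  rw [Equiv.swap_apply_of_ne_of_ne]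
  · rintro rfl; exact ha hi
  · rintro rfl; exact hb hi

lemma F_reindex {I G : Type*} [AddCommGroup G] [Fintype I] (x : I → G)
    (σ : Equiv.Perm I) (e : Equiv.Perm I) :
    F x σ = Multiset.map (fun i => x (e i) + x (σ (e i))) Finset.univ.val := by
  unfold F
  have : (Finset.univ : Finset I).val = Multiset.map e Finset.univ.val := by
    have := congrArg Finset.val (Finset.map_univ_equiv e)
    simpa using this.symm
  conv_lhs => rw [this]
  rw [Multiset.map_map]
  rfl

lemma F_sum {I G : Type*} [AddCommGroup G] [Fintype I] (x : I → G) (σ : Equiv.Perm I) :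
    (F x σ).sum = ∑ i, x i + ∑ i, x i := by
  have : (F x σ).sum = ∑ i, (x i + x (σ i)) := rfl
  rw [this, Finset.sum_add_distrib, Equiv.sum_comp σ x]

lemma two_sum (G : Type*) [AddCommGroup G] [Fintype G] : ∑ i : G, i + ∑ i : G, i = 0 := by
  have : ∑ i : G, -i = ∑ i : G, i := Equiv.sum_comp (Equiv.neg G) (fun i => i)
  rw [Finset.sum_neg_distrib] at this
  nth_rewrite 1 [← this]
  simp

/-- Multiplying by a transposition inside a cycle splits the cycle. -/
lemma split_cycle {I : Type*} [Fintype I] [DecidableEq I] (τ : Equiv.Perm I) {a b : I}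
    (hab : a ≠ b) (h : τ.SameCycle a b) : ¬ (τ * Equiv.swap a b).SameCycle a b := by
  classical
  have hex : ∃ i : ℕ, (τ ^ i) a = b := by
    obtain ⟨i, _, hi⟩ := h.exists_pow_eq'
    exact ⟨i, hi⟩
  obtain ⟨m, hm, hmin⟩ : ∃ m : ℕ, (τ ^ m) a = b ∧ ∀ k < m, (τ ^ k) a ≠ b :=
    ⟨Nat.find hex, Nat.find_spec hex, fun k hk => Nat.find_min hex hk⟩
  have hm0 : 1 ≤ m := by
    rcases Nat.eq_zero_or_pos m with h0 | h0
    · subst h0; exact absurd hm hab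
    · exact h0
  have hna : ∀ k, 1 ≤ k → k ≤ m → (τ ^ k) a ≠ a := by
    intro k h1 h2 hk
    have : (τ ^ (m - k)) a = b := by
      rw [← hm]
      conv_rhs => rw [← Nat.sub_add_cancel h2, pow_add, Equiv.Perm.mul_apply, hk]
    exact hmin _ (by omega) this
  have key : ∀ j : ℕ, ∃ k, 1 ≤ k ∧ k ≤ m ∧ ((τ * Equiv.swap a b) ^ j) b = (τ ^ k) a := by
    intro j
    induction j with
    | zero => exact ⟨m, hm0, le_rfl, hm.symm⟩
    | succ j ih =>
      obtain ⟨k, h1, h2, hk⟩ := ih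
      rw [pow_succ', Equiv.Perm.mul_apply, hk, Equiv.Perm.mul_apply]
      rcases Nat.lt_or_ge k m with hlt | hge
      · refine ⟨k + 1, by omega, hlt, ?_⟩
        rw [Equiv.swap_apply_of_ne_of_ne (hna k h1 h2) (hmin k hlt), pow_succ',
          Equiv.Perm.mul_apply]
      · have : k = m := le_antisymm h2 hge
        subst this
        refine ⟨1, le_rfl, hm0, ?_⟩
        rw [hm, Equiv.swap_apply_right, pow_one]
  intro hs
  obtain ⟨j, _, hj⟩ := hs.symm.exists_pow_eq'
  obtain ⟨k, h1, h2, hk⟩ := key j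
  exact hna k h1 h2 (hk.symm.trans hj)

lemma step_aux {I G : Type*} [AddCommGroup G] [Fintype I] [DecidableEq I] (x : I → G)
    (τ : Equiv.Perm I) {a b : I} (hs : ¬ τ.SameCycle a b) (N : Multiset G)
    (hN : F x τ = (x a + x (τ a)) ::ₘ (x b + x (τ b)) ::ₘ N) :
    ∃ (τ' : Equiv.Perm I) (w : G), F x τ' = (x a + x b) ::ₘ w ::ₘ N := by
  classical
  set c := τ.cycleOf b with hc
  set ρ := τ * (c⁻¹ * c⁻¹) with hρ
  have off : ∀ z, ¬ τ.SameCycle b z → c z = z := fun z hz =>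
    Equiv.Perm.cycleOf_apply_of_not_sameCycle hz
  have on : ∀ z, τ.SameCycle b z → c z = τ z := fun z hz => hz.cycleOf_apply
  have ρoff : ∀ z, ¬ τ.SameCycle b z → ρ z = τ z := by
    intro z hz
    have : c⁻¹ z = z := by rw [Equiv.Perm.inv_eq_iff_eq, off z hz]
    rw [hρ, Equiv.Perm.mul_apply, Equiv.Perm.mul_apply, this, this]
  have ρon : ∀ z, τ.SameCycle b z → ρ (τ z) = z := by
    intro z hz
    have h1 : c⁻¹ (τ z) = z := by rw [Equiv.Perm.inv_eq_iff_eq, on z hz]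
    have h2 : c⁻¹ z = τ⁻¹ z := by
      have h3 : τ.SameCycle b (τ⁻¹ z) := by
        rw [← Equiv.Perm.sameCycle_apply_right]
        simpa using hz
      rw [Equiv.Perm.inv_eq_iff_eq, on _ h3]
      simp
    rw [hρ, Equiv.Perm.mul_apply, Equiv.Perm.mul_apply, h1, h2]
    simp
  have hF : F x ρ = F x τ := by
    rw [F_reindex x ρ c]
    unfold F
    apply Multiset.map_congr rfl
    intro z _
    by_cases hz : τ.SameCycle b z
    · rw [on z hz, ρon z hz, add_comm]
    · rw [off z hz, ρoff z hz]
  have hsa : ¬ τ.SameCycle b a := fun h => hs h.symm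
  have hab : a ≠ τ b := by
    intro h
    apply hsa
    rw [h]
    exact Equiv.Perm.sameCycle_apply_right.2 (Equiv.Perm.SameCycle.refl _ _)
  have hρb : ρ (τ b) = b := ρon b (Equiv.Perm.SameCycle.refl _ _)
  refine ⟨ρ * Equiv.swap a (τ b), x (τ b) + x (ρ a), ?_⟩
  have := F_swap x ρ hab N (by rw [hF, hN, hρb, ρoff a hsa, add_comm (x b)])
  rw [this, hρb]

lemma step {I G : Type*} [AddCommGroup G] [Fintype I] (x : I → G)
    (τ : Equiv.Perm I) {a b : I} (hab : a ≠ b) (N : Multiset G)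
    (hN : F x τ = (x a + x (τ a)) ::ₘ (x b + x (τ b)) ::ₘ N) :
    ∃ (τ' : Equiv.Perm I) (w : G), F x τ' = (x a + x b) ::ₘ w ::ₘ N := by
  classical
  by_cases hs : τ.SameCycle a b
  · refine step_aux x (τ * Equiv.swap a b) (split_cycle τ hab hs) N ?_
    rw [F_swap x τ hab N hN]
    simp
  · exact step_aux x τ hs N hN

lemma F_shift {G : Type*} [AddCommGroup G] [Fintype G] (σ : Equiv.Perm G) (K : G) :
    F id (Equiv.addRight K * σ) = (F id σ).map (fun z => z + K) := by
  unfold F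
  rw [Multiset.map_map]
  apply Multiset.map_congr rfl
  intro i _
  simp [add_assoc]

lemma exchange {G : Type*} [AddCommGroup G] [Fintype G] (σ : Equiv.Perm G) (a b a' : G)
    (N : Multiset G) (h : F id σ = a ::ₘ b ::ₘ N) :
    ∃ (σ' : Equiv.Perm G) (w : G), F id σ' = a' ::ₘ w ::ₘ N := by
  classical
  have ha : a ∈ F id σ := by rw [h]; simp
  obtain ⟨x1, -, hx1⟩ := Multiset.mem_map.1 ha
  obtain ⟨S, hS⟩ := Multiset.exists_cons_of_mem (Finset.mem_univ_val x1)
  have h' := h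
  unfold F at h'
  rw [hS, Multiset.map_cons, hx1, Multiset.cons_inj_right] at h'
  have hb : b ∈ Multiset.map (fun i => id i + id (σ i)) S := by rw [h']; simp
  obtain ⟨x2, hx2S, hx2⟩ := Multiset.mem_map.1 hb
  have hne : x1 ≠ x2 := by
    rintro rfl
    have nd : (x1 ::ₘ S).Nodup := by rw [← hS]; exact Finset.univ.nodup
    exact (Multiset.nodup_cons.1 nd).1 hx2S
  simp only [id] at hx1 hx2
  obtain ⟨τ', w, hw⟩ := step (x := (id : G → G)) (Equiv.addRight (-(a' - x1 - x2)) * σ) hne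
    (N.map (fun z => z + -(a' - x1 - x2))) (by
      rw [F_shift, h]
      simp [← hx1, ← hx2, add_assoc])
  refine ⟨Equiv.addRight (a' - x1 - x2) * τ', w + (a' - x1 - x2), ?_⟩
  rw [F_shift, hw]
  simp only [Multiset.map_cons, Multiset.map_map, Function.comp_def, neg_add_cancel_right, id,
    Multiset.map_id']
  congr 1
  abel

lemma hall_aux {G : Type*} [AddCommGroup G] [Fintype G] (N : Multiset G) :
    ∀ r : ℕ, Multiset.card N + r + 1 = Fintype.card G →
    ∃ (σ : Equiv.Perm G) (w : G), F id σ = w ::ₘ (N + Multiset.replicate r 0) := by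
  induction N using Multiset.induction_on with
  | empty =>
    intro r hr
    refine ⟨Equiv.neg G, 0, ?_⟩
    rw [zero_add, ← Multiset.replicate_succ, Multiset.eq_replicate]
    constructor
    · simp only [F, Multiset.card_map, Finset.card_val, Finset.card_univ]
      simp at hr
      omega
    · intro b hb
      obtain ⟨i, -, hi⟩ := Multiset.mem_map.1 hb
      simpa using hi.symm
  | cons a N ih =>
    intro r hr
    rw [Multiset.card_cons] at hr
    obtain ⟨σ, w, h⟩ := ih (r + 1) (by omega)
    obtain ⟨σ', w', h'⟩ := exchange σ w 0 a (N + Multiset.replicate r 0) (by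
      rw [h, Multiset.replicate_succ, Multiset.add_cons])
    exact ⟨σ', w', by rw [h', Multiset.cons_swap, Multiset.cons_add]⟩

/-- Marshall Hall's theorem. -/
lemma hall {G : Type*} [AddCommGroup G] [Fintype G] (M : Multiset G)
    (hM : Multiset.card M = Fintype.card G) (h0 : M.sum = 0) :
    ∃ σ : Equiv.Perm G, F id σ = M := by
  have hpos : 0 < Multiset.card M := by rw [hM]; exact Fintype.card_pos
  obtain ⟨b, hb⟩ := Multiset.card_pos_iff_exists_mem.1 hpos
  obtain ⟨N, rfl⟩ := Multiset.exists_cons_of_mem hb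
  rw [Multiset.card_cons] at hM
  obtain ⟨σ, w, h⟩ := hall_aux N 0 (by omega)
  refine ⟨σ, ?_⟩
  have hs := F_sum (id : G → G) σ
  simp only [id, two_sum] at hs
  simp only [Multiset.replicate_zero, add_zero] at h
  rw [h, Multiset.sum_cons] at hs
  rw [Multiset.sum_cons] at h0
  rw [h, add_right_cancel (hs.trans h0.symm)]

end ExtCayley

/-- The extended Cayley table: let `G` be a finite abelian group of order `n`, let
`I = G ⊕ Unit` (index set with `n+1` elements) and `x : I → G` be `x(g) = g`, `x(∗) = 0`.
A multiset `M` of elements of `G` with `card M = n+1` is of the form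
`{x(i) + x(π(i)) : i ∈ I}` for some bijection `π` of `I` if and only if the sum of the
elements of `M` is `0`; equivalently, a monomial of degree `n+1` occurs in the permanent
of the extended Cayley table of `G` iff its multiset of variables sums to `0`. -/
theorem extended_cayley_permanent_monomials (G : Type*) [AddCommGroup G] [Fintype G]
    (M : Multiset G) (hM : Multiset.card M = Fintype.card G + 1) :
    (∃ π : Equiv.Perm (G ⊕ Unit),
        M = Multiset.map
          (fun i => Sum.elim id (fun _ => (0 : G)) i + Sum.elim id (fun _ => (0 : G)) (π i))
          Finset.univ.val) ↔
      M.sum = 0 := by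
  classical
  change (∃ π : Equiv.Perm (G ⊕ Unit),
    M = ExtCayley.F (Sum.elim id (fun _ => (0 : G))) π) ↔ M.sum = 0
  constructor
  · rintro ⟨π, rfl⟩
    rw [ExtCayley.F_sum]
    simpa using ExtCayley.two_sum G
  · intro h0
    have hpos : 0 < Fintype.card G := Fintype.card_pos
    obtain ⟨m0, hm0⟩ := Multiset.card_pos_iff_exists_mem.1 (show 0 < Multiset.card M by omega)
    obtain ⟨M1, rfl⟩ := Multiset.exists_cons_of_mem hm0
    rw [Multiset.card_cons] at hM
    obtain ⟨m1, hm1⟩ := Multiset.card_pos_iff_exists_mem.1 (show 0 < Multiset.card M1 by omega)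
    obtain ⟨N, rfl⟩ := Multiset.exists_cons_of_mem hm1
    rw [Multiset.card_cons] at hM
    obtain ⟨σ, hσ⟩ := ExtCayley.hall ((m0 + m1) ::ₘ N) (by rw [Multiset.card_cons]; omega)
      (by rw [← h0]; simp [add_assoc])
    have hmem : m0 + m1 ∈ ExtCayley.F id σ := by rw [hσ]; simp
    obtain ⟨g, -, hg⟩ := Multiset.mem_map.1 hmem
    simp only [id] at hg
    let σ' : Equiv.Perm G := Equiv.addRight (g - m0) * σ * Equiv.addRight (g - m0)
    have hσ' : ExtCayley.F id σ' = (m0 + m1) ::ₘ N := by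
      rw [← hσ, ExtCayley.F_reindex id σ (Equiv.addRight (g - m0))]
      unfold ExtCayley.F
      apply Multiset.map_congr rfl
      intro i _
      simp only [σ', id, Equiv.Perm.mul_apply, Equiv.coe_addRight]
      abel
    have hm : σ' m0 = m1 := by
      simp only [σ', Equiv.Perm.mul_apply, Equiv.coe_addRight, add_sub_cancel]
      have : σ g + (g - m0) = (g + σ g) - m0 := by abel
      rw [this, hg]; abel
    have hF : ExtCayley.F (Sum.elim id (fun _ => (0 : G))) (Equiv.sumCongr σ' (1 : Equiv.Perm Unit))
        = (0 : G) ::ₘ ExtCayley.F id σ' := by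
      have hu : (Finset.univ : Finset (G ⊕ Unit)).val
          = Sum.inr () ::ₘ Multiset.map Sum.inl (Finset.univ : Finset G).val := by
        rw [← Multiset.singleton_add, add_comm]
        rfl
      unfold ExtCayley.F
      rw [hu, Multiset.map_cons, Multiset.map_map]
      simp [Function.comp_def]
    refine ⟨Equiv.sumCongr σ' (1 : Equiv.Perm Unit) * Equiv.swap (Sum.inl m0) (Sum.inr ()), ?_⟩
    rw [ExtCayley.F_swap _ _ (by simp) N]
    · simp [hm]
    · rw [hF, hσ', Multiset.cons_swap]
      simp [hm]
end

section
/- Let G be a finite abelian group, written additively, of order n, let I = G ⊔ {∗} with x : I → G given by x(g) = g and x(∗) = 0, and let per(M̃_G) = Σ_{π ∈ Perm(I)} ∏_{i∈I} x_{x(i)+x(π(i))} be the permanent of the extended Cayley table, an element of ℂ[x_g : g ∈ G]. Then the number of monomials occurring with nonzero coefficient in per(M̃_G) equals the dimension over ℂ of the space of G-invariant homogeneous polynomials of degree n+1 in ℂ[x_g : g ∈ G], where G acts by γ · x_g = x_{g+γ}. -/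
open Finset MvPolynomial

/-- Cutting a permutation: `σ` or `swap p q * σ` preserves a set containing `q` but not `p`. -/
lemma exists_separating_set {ι : Type*} [Fintype ι] [DecidableEq ι] (σ : Equiv.Perm ι)
    (p q : ι) (hpq : p ≠ q) :
    ∃ D : Set ι, q ∈ D ∧ p ∉ D ∧
      ((∀ i ∈ D, σ i ∈ D) ∨ (∀ i ∈ D, Equiv.swap p q (σ i) ∈ D)) := by
  classical
  have hex : ∃ k : ℕ, (σ ^ (k + 1)) q = p ∨ (σ ^ (k + 1)) q = q := by
    refine ⟨orderOf σ - 1, Or.inr ?_⟩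
    have := orderOf_pos σ
    rw [Nat.sub_add_cancel this, pow_orderOf_eq_one]; rfl
  have hk := Nat.find_spec hex
  have hmin : ∀ m < Nat.find hex, ¬ ((σ ^ (m + 1)) q = p ∨ (σ ^ (m + 1)) q = q) :=
    fun m hm => Nat.find_min hex hm
  generalize Nat.find hex = k at hk hmin
  refine ⟨{x | ∃ i ≤ k, (σ ^ i) q = x}, ⟨0, by omega, rfl⟩, ?_, ?_⟩
  · rintro ⟨i, hi, h⟩
    rcases i with _ | i
    · exact hpq h.symm
    · exact hmin i (by omega) (Or.inl h)
  · have hs : ∀ i, σ ((σ ^ i) q) = (σ ^ (i + 1)) q := fun i => by rw [pow_succ']; rfl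
    rcases hk with hk | hk
    · right
      rintro x ⟨i, hi, rfl⟩
      rw [hs]
      rcases hi.lt_or_eq with h | h
      · have := hmin i h
        push Not at this
        rw [Equiv.swap_apply_of_ne_of_ne this.1 this.2]
        exact ⟨i + 1, h, rfl⟩
      · subst h
        rw [hk, Equiv.swap_apply_left]
        exact ⟨0, by omega, rfl⟩
    · left
      rintro x ⟨i, hi, rfl⟩
      rw [hs]
      rcases hi.lt_or_eq with h | h
      · exact ⟨i + 1, h, rfl⟩
      · subst h
        rw [hk]
        exact ⟨0, by omega, rfl⟩

/-- One step of Hall's theorem, when `p` and `q` are separated. -/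
lemma hall_step_aux {G ι : Type*} [AddCommGroup G] [Fintype ι] [DecidableEq ι]
    (b c : ι ≃ G) (p q : ι) (S : G) (D : Set ι) (hq : q ∈ D) (hp : p ∉ D)
    (hD : ∀ i ∈ D, b.symm (S - c i) ∈ D) :
    ∃ b' c' : ι ≃ G, (∀ i, i ≠ p → i ≠ q → b' i - c' i = b i - c i) ∧
      b' p - c' p = S - c q - c p := by
  classical
  have : Finite G := Finite.of_equiv ι b
  have hD' : ∀ i, b.symm (S - c i) ∈ D → i ∈ D := by
    let τ : Equiv.Perm ι := (c.trans (Equiv.subLeft S)).trans b.symm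
    have hm : Set.MapsTo τ D D := hD
    intro i hi
    have hsurj : Set.SurjOn τ D D :=
      ((Set.Finite.injOn_iff_bijOn_of_mapsTo (Set.toFinite D) hm).1 τ.injective.injOn).surjOn
    obtain ⟨j, hj, hji⟩ := hsurj hi
    have : j = i := τ.injective hji
    exact this ▸ hj
  let fb : ι → G := fun i => if i ∈ D then S - c i else b i
  let fc : ι → G := fun i => if i ∈ D then S - b i else c i
  have hfb : Function.Injective fb := by
    intro i j h
    simp only [fb] at h
    split_ifs at h with hi hj hj
    · exact c.injective (sub_right_injective h)
    · exact absurd (by simpa [h] using hD i hi) hj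
    · exact absurd (by simpa [← h] using hD j hj) hi
    · exact b.injective h
  have hfc : Function.Injective fc := by
    intro i j h
    simp only [fc] at h
    split_ifs at h with hi hj hj
    · exact b.injective (sub_right_injective h)
    · exact absurd (hD' j (by rw [← h]; simpa using hi)) hj
    · exact absurd (hD' i (by rw [h]; simpa using hj)) hi
    · exact c.injective h
  have hcard : Nat.card ι = Nat.card G := Nat.card_congr b
  have hbb : Function.Bijective fb := (Nat.bijective_iff_injective_and_card fb).2 ⟨hfb, hcard⟩
  have hcb : Function.Bijective fc := (Nat.bijective_iff_injective_and_card fc).2 ⟨hfc, hcard⟩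
  refine ⟨(Equiv.swap p q).trans (Equiv.ofBijective fb hbb), Equiv.ofBijective fc hcb, ?_, ?_⟩
  · intro i hip hiq
    simp only [Equiv.trans_apply, Equiv.ofBijective_apply,
      Equiv.swap_apply_of_ne_of_ne hip hiq, fb, fc]
    split_ifs <;> abel
  · simp [fb, fc, hp, hq]

lemma hall_step_s17 {G ι : Type*} [AddCommGroup G] [Fintype ι] [DecidableEq ι]
    (b c : ι ≃ G) (p q : ι) (hpq : p ≠ q) (z : G) :
    ∃ b' c' : ι ≃ G, (∀ i, i ≠ p → i ≠ q → b' i - c' i = b i - c i) ∧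
      b' p - c' p = z := by
  set S := z + c p + c q with hS
  obtain ⟨D, hq, hp, hD⟩ := exists_separating_set
    ((c.trans (Equiv.subLeft S)).trans b.symm) p q hpq
  rcases hD with hD | hD
  · obtain ⟨b', c', h1, h2⟩ := hall_step_aux b c p q S D hq hp (fun i hi => by simpa using hD i hi)
    exact ⟨b', c', h1, by rw [h2, hS]; abel⟩
  · obtain ⟨b', c', h1, h2⟩ := hall_step_aux ((Equiv.swap p q).trans b) c p q S D hq hp
      (fun i hi => by simpa using hD i hi)
    refine ⟨b', c', fun i hip hiq => ?_, by rw [h2, hS]; abel⟩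
    rw [h1 i hip hiq]
    simp [Equiv.swap_apply_of_ne_of_ne hip hiq]

/-- M. Hall's theorem on differences of enumerations of a finite abelian group. -/
lemma hall_differences {G ι : Type*} [AddCommGroup G] [Fintype ι] [DecidableEq ι]
    (e : ι ≃ G) (a : ι → G) (ha : ∑ i, a i = 0) :
    ∃ b c : ι ≃ G, ∀ i, a i = b i - c i := by
  classical
  have : Fintype G := Fintype.ofEquiv ι e
  induction hn : (univ.filter (fun i => a i ≠ 0)).card using Nat.strong_induction_on
    generalizing a with
  | _ n ih =>
    by_cases h0 : ∀ i, a i = 0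
    · exact ⟨e, e, fun i => by simp [h0 i]⟩
    · push Not at h0
      obtain ⟨p, hp⟩ := h0
      obtain ⟨q, hqp, hq⟩ : ∃ q, q ≠ p ∧ a q ≠ 0 := by
        by_contra! h
        apply hp
        rw [← ha, Finset.sum_eq_single p (fun i _ hi => h i hi) (by simp)]
      let a0 : ι → G := fun i => if i = p then 0 else if i = q then a p + a q else a i
      have hrest : ∀ f : ι → G, ∑ i, f i = f p + (f q + ∑ i ∈ (univ.erase p).erase q, f i) := by
        intro f
        rw [Finset.add_sum_erase _ f (by simp [hqp]), Finset.add_sum_erase _ f (by simp)]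
      have hs : ∑ i, a0 i = 0 := by
        rw [hrest a0, ← ha, hrest a]
        have : ∑ i ∈ (univ.erase p).erase q, a0 i = ∑ i ∈ (univ.erase p).erase q, a i := by
          apply Finset.sum_congr rfl
          intro i hi
          simp only [mem_erase, mem_univ, and_true] at hi
          simp [a0, hi.1, hi.2]
        rw [this]
        simp only [a0, hqp, if_true, if_false]
        abel
      have hlt : (univ.filter (fun i => a0 i ≠ 0)).card < n := by
        rw [← hn]
        apply Finset.card_lt_card
        rw [Finset.ssubset_iff_of_subset]
        · exact ⟨p, by simp [hp], by simp [a0]⟩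
        · intro i hi
          simp only [mem_filter, mem_univ, true_and, a0] at hi ⊢
          split_ifs at hi with h1 h2
          · exact absurd rfl hi
          · rw [h2]; exact hq
          · exact hi
      obtain ⟨b, c, hbc⟩ := ih _ hlt a0 hs rfl
      obtain ⟨b', c', h1, h2⟩ := hall_step_s17 b c p q hqp.symm (a p)
      have h3 : ∀ i, i ≠ p → i ≠ q → a i = b' i - c' i := by
        intro i hip hiq
        rw [h1 i hip hiq, ← hbc i]
        simp [a0, hip, hiq]
      refine ⟨b', c', fun i => ?_⟩
      by_cases hip : i = p
      · rw [hip, h2]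
      by_cases hiq : i = q
      · have hz : ∑ i, (b' i - c' i) = 0 := by
          rw [Finset.sum_sub_distrib, Equiv.sum_comp b' (fun x => x), Equiv.sum_comp c' (fun x => x),
            sub_self]
        rw [← ha, hrest a, hrest (fun i => b' i - c' i), h2] at hz
        have : ∑ i ∈ (univ.erase p).erase q, (b' i - c' i) =
            ∑ i ∈ (univ.erase p).erase q, a i := by
          apply Finset.sum_congr rfl
          intro i hi
          simp only [mem_erase, mem_univ, and_true] at hi
          exact (h3 i hi.2 hi.1).symm
        rw [this] at hz
        rw [hiq]
        exact (add_right_cancel (add_left_cancel hz)).symm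
      · exact h3 i hip hiq

/-- The labelling of the extended index set. -/
def extLabel {G : Type*} [AddCommGroup G] : G ⊕ Unit → G := Sum.elim id (fun _ => (0 : G))

lemma extended_hall {G : Type*} [AddCommGroup G] [Fintype G] [DecidableEq G]
    (a : G ⊕ Unit → G) (ha : ∑ i, a i = 0) :
    ∃ σ τ : Equiv.Perm (G ⊕ Unit), ∀ i, extLabel (σ i) + extLabel (τ i) = a i := by
  classical
  have hsum : ∑ g : G, (a (Sum.inl g) + if g = 0 then a (Sum.inr ()) else 0) = 0 := by
    rw [Finset.sum_add_distrib, Finset.sum_ite_eq' univ (0 : G)]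
    simpa using ha
  obtain ⟨b, c, hbc⟩ := hall_differences (Equiv.refl G) _ hsum
  have h0 := hbc 0
  simp only [if_true] at h0
  set y := c 0 + a (Sum.inr ()) with hy
  refine ⟨Equiv.sumCongr (b.trans (Equiv.subRight y)) (Equiv.refl _),
    (Equiv.swap (Sum.inl 0) (Sum.inr ())).trans
      (Equiv.sumCongr (c.trans (Equiv.subLeft y)) (Equiv.refl _)), ?_⟩
  rintro (g | u)
  · by_cases hg : g = 0
    · subst hg
      simp only [Equiv.trans_apply, Equiv.swap_apply_left]
      simp only [extLabel, Equiv.sumCongr_apply, Sum.map_inl, Sum.map_inr, Sum.elim_inl,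
        Sum.elim_inr, Equiv.trans_apply, Equiv.subRight_apply, id, add_zero]
      rw [hy, eq_comm, ← sub_sub, ← h0]
      abel
    · have hgg := hbc g
      simp only [hg, if_false, add_zero] at hgg
      rw [Equiv.trans_apply, Equiv.swap_apply_of_ne_of_ne (by simpa using hg) (by simp)]
      simp [extLabel, hgg]
  · simp [extLabel, hy]

/-- The total weight of an exponent vector. -/
def expSum {G : Type*} [AddCommGroup G] (m : G →₀ ℕ) : G := m.sum (fun g k => k • g)

lemma exists_labelling {G : Type*} [AddCommGroup G] [Fintype G] [DecidableEq G]
    (m : G →₀ ℕ) (hm : m.degree = Fintype.card G + 1) :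
    ∃ a : G ⊕ Unit → G, ∑ i, Finsupp.single (a i) 1 = m := by
  classical
  have hc : m.toMultiset.card = Fintype.card G + 1 := by
    rw [Finsupp.card_toMultiset, ← hm]; rfl
  obtain ⟨l, hl⟩ := Quot.exists_rep m.toMultiset
  have hl' : (l : Multiset G) = m.toMultiset := hl
  have hlen : l.length = Fintype.card G + 1 := by rw [← hc, ← hl']; rfl
  have e : G ⊕ Unit ≃ Fin l.length := Fintype.equivOfCardEq (by simp [hlen])
  refine ⟨fun i => l.get (e i), ?_⟩
  rw [Equiv.sum_comp e (fun j => Finsupp.single (l.get j) 1)]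
  apply (Multiset.toFinsupp (α := G)).symm.injective
  change Finsupp.toMultiset _ = Finsupp.toMultiset _
  rw [map_sum, ← hl']
  simp only [Finsupp.toMultiset_single, one_smul]
  rw [← List.sum_ofFn]
  conv_rhs => rw [← List.ofFn_get l]
  generalize l.get = f
  rw [← Multiset.sum_map_singleton (↑(List.ofFn f) : Multiset G)]
  rw [Multiset.map_coe, Multiset.sum_coe, List.map_ofFn]
  rfl

lemma expSum_add {G : Type*} [AddCommGroup G] (m m' : G →₀ ℕ) :
    expSum (m + m') = expSum m + expSum m' := by
  classical
  exact Finsupp.sum_add_index' (by simp) (by intros; rw [add_smul])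

lemma expSum_sum_single {G ι : Type*} [AddCommGroup G] (s : Finset ι) (a : ι → G) :
    expSum (∑ i ∈ s, Finsupp.single (a i) 1) = ∑ i ∈ s, a i := by
  classical
  induction s using Finset.induction_on with
  | empty => simp [expSum]
  | insert i s hi ih =>
    rw [Finset.sum_insert hi, Finset.sum_insert hi, expSum_add, ih]
    simp [expSum]

lemma degree_sum_single {G ι : Type*} [AddCommGroup G] (s : Finset ι) (a : ι → G) :
    (∑ i ∈ s, Finsupp.single (a i) 1 : G →₀ ℕ).degree = s.card := by
  simp [map_sum, Finsupp.degree_single]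

lemma sum_extLabel {G : Type*} [AddCommGroup G] [Fintype G] (π : Equiv.Perm (G ⊕ Unit)) :
    ∑ i, (extLabel i + extLabel (π i)) = (0 : G) := by
  rw [Finset.sum_add_distrib, Equiv.sum_comp π (extLabel (G := G))]
  simp only [extLabel, Fintype.sum_sum_type, Sum.elim_inl, Sum.elim_inr, id, Finset.sum_const_zero,
    add_zero]
  have : ∑ x : G, x = ∑ x : G, -x := (Equiv.sum_comp (Equiv.neg G) (fun x => x)).symm
  nth_rewrite 1 [this]
  rw [Finset.sum_neg_distrib, neg_add_cancel]

lemma mem_support_permanent {G : Type*} [AddCommGroup G] [Fintype G] [DecidableEq G]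
    (m : G →₀ ℕ) :
    m ∈ (∑ π : Equiv.Perm (G ⊕ Unit), ∏ i : G ⊕ Unit,
        (X (extLabel i + extLabel (π i)) : MvPolynomial G ℂ)).support ↔
      m.degree = Fintype.card G + 1 ∧ expSum m = 0 := by
  classical
  have hprod : ∀ π : Equiv.Perm (G ⊕ Unit), ∏ i : G ⊕ Unit,
        (X (extLabel i + extLabel (π i)) : MvPolynomial G ℂ) =
        monomial (∑ i, Finsupp.single (extLabel i + extLabel (π i)) 1) 1 := by
    intro π
    rw [monomial_sum_one]
    rfl
  have key : m ∈ (∑ π : Equiv.Perm (G ⊕ Unit), ∏ i : G ⊕ Unit,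
        (X (extLabel i + extLabel (π i)) : MvPolynomial G ℂ)).support ↔
      ∃ π : Equiv.Perm (G ⊕ Unit), ∑ i, Finsupp.single (extLabel i + extLabel (π i)) 1 = m := by
    rw [mem_support_iff]
    simp only [hprod, coeff_sum, coeff_monomial]
    rw [Finset.sum_boole, Nat.cast_ne_zero, Finset.card_ne_zero]
    simp [Finset.Nonempty]
  rw [key]
  constructor
  · rintro ⟨π, rfl⟩
    rw [degree_sum_single, expSum_sum_single, sum_extLabel]
    simp
  · rintro ⟨h1, h2⟩
    obtain ⟨a, rfl⟩ := exists_labelling m h1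
    rw [expSum_sum_single] at h2
    obtain ⟨σ, τ, h⟩ := extended_hall a h2
    refine ⟨σ⁻¹.trans τ, ?_⟩
    rw [← Equiv.sum_comp σ]
    apply Finset.sum_congr rfl
    intro i _
    rw [← h i]
    simp

/-- Translation of exponent vectors. -/
noncomputable def shiftExp {G : Type*} [AddCommGroup G] (γ : G) (m : G →₀ ℕ) : G →₀ ℕ :=
  m.mapDomain (fun g => g + γ)

lemma degree_shiftExp {G : Type*} [AddCommGroup G] (γ : G) (m : G →₀ ℕ) :
    (shiftExp γ m).degree = m.degree := by
  simp [shiftExp, Finsupp.degree_mapDomain]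

lemma shiftExp_shiftExp {G : Type*} [AddCommGroup G] (γ δ : G) (m : G →₀ ℕ) :
    shiftExp γ (shiftExp δ m) = shiftExp (δ + γ) m := by
  unfold shiftExp
  rw [← Finsupp.mapDomain_comp]
  congr 1
  funext g
  simp [add_assoc]

lemma shiftExp_zero {G : Type*} [AddCommGroup G] (m : G →₀ ℕ) :
    shiftExp 0 m = m := by
  have : (fun g : G => g + 0) = id := by funext g; simp
  rw [shiftExp, this, Finsupp.mapDomain_id]

lemma expSum_shiftExp {G : Type*} [AddCommGroup G] (γ : G) (m : G →₀ ℕ) :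
    expSum (shiftExp γ m) = expSum m + m.degree • γ := by
  classical
  induction m using Finsupp.induction_linear with
  | zero => simp [shiftExp, expSum]
  | add f g hf hg =>
    have : shiftExp γ (f + g) = shiftExp γ f + shiftExp γ g := Finsupp.mapDomain_add
    rw [this, expSum_add, hf, hg, expSum_add, map_add, add_smul]
    abel
  | single a k =>
    simp [shiftExp, expSum, Finsupp.mapDomain_single, Finsupp.degree_single, smul_add]

lemma expSum_shiftExp' {G : Type*} [AddCommGroup G] [Fintype G] (γ : G) (m : G →₀ ℕ)
    (hm : m.degree = Fintype.card G + 1) :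
    expSum (shiftExp γ m) = expSum m + γ := by
  rw [expSum_shiftExp, hm, add_smul, card_nsmul_eq_zero, zero_add, one_smul]

/-- The invariant subspace. -/
noncomputable def invSub (G : Type*) [AddCommGroup G] [Fintype G] :
    Submodule ℂ (MvPolynomial G ℂ) :=
  homogeneousSubmodule G ℂ (Fintype.card G + 1) ⊓
        ⨅ γ : G, LinearMap.eqLocus
          (rename (fun g => g + γ) : MvPolynomial G ℂ →ₐ[ℂ] MvPolynomial G ℂ).toLinearMap
          LinearMap.id

lemma mem_invSub {G : Type*} [AddCommGroup G] [Fintype G] (p : MvPolynomial G ℂ) :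
    p ∈ invSub G ↔ p.IsHomogeneous (Fintype.card G + 1) ∧
      ∀ γ : G, rename (fun g => g + γ) p = p := by
  simp [invSub, Submodule.mem_inf, Submodule.mem_iInf, LinearMap.mem_eqLocus]

lemma coeff_shiftExp {G : Type*} [AddCommGroup G] [Fintype G] (p : MvPolynomial G ℂ)
    (hp : p ∈ invSub G) (γ : G) (m : G →₀ ℕ) :
    coeff (shiftExp γ m) p = coeff m p := by
  have h := ((mem_invSub p).1 hp).2 γ
  conv_lhs => rw [← h]
  exact coeff_rename_mapDomain _ (add_left_injective γ) p m

lemma orbit_mem {G : Type*} [AddCommGroup G] [Fintype G] (m : G →₀ ℕ)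
    (hm : m.degree = Fintype.card G + 1) :
    ∑ γ : G, monomial (shiftExp γ m) (1 : ℂ) ∈ invSub G := by
  rw [mem_invSub]
  constructor
  · apply IsHomogeneous.sum
    intro γ _
    apply isHomogeneous_monomial
    rw [degree_shiftExp, hm]
  · intro γ
    rw [map_sum]
    simp only [rename_monomial]
    change ∑ δ : G, monomial (shiftExp γ (shiftExp δ m)) (1 : ℂ) = _
    simp only [shiftExp_shiftExp]
    exact Equiv.sum_comp (Equiv.addRight γ) (fun δ => monomial (shiftExp δ m) (1 : ℂ))

lemma finrank_invSub {G : Type*} [AddCommGroup G] [Fintype G] (T : Finset (G →₀ ℕ))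
    (hT : ∀ m, m ∈ T ↔ m.degree = Fintype.card G + 1 ∧ expSum m = 0) :
    Module.finrank ℂ (invSub G) = T.card := by
  classical
  let Φ : invSub G →ₗ[ℂ] (T → ℂ) :=
    LinearMap.pi (fun m => (lcoeff ℂ (m : G →₀ ℕ)).comp (invSub G).subtype)
  have hΦ : ∀ p m, Φ p m = coeff (m : G →₀ ℕ) (p : MvPolynomial G ℂ) := fun p m => rfl
  have hinj : Function.Injective Φ := by
    rw [injective_iff_map_eq_zero]
    intro p hp
    apply Subtype.ext
    ext m
    simp only [ZeroMemClass.coe_zero, coeff_zero]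
    by_contra hne
    have hd : m.degree = Fintype.card G + 1 := by
      have := ((mem_invSub _).1 p.2).1 hne
      rwa [Finsupp.degree_eq_weight_one]
    have hmem : shiftExp (-expSum m) m ∈ T := by
      rw [hT, degree_shiftExp, expSum_shiftExp' _ _ hd]
      exact ⟨hd, add_neg_cancel _⟩
    have h := congrFun hp ⟨_, hmem⟩
    rw [hΦ, coeff_shiftExp _ p.2] at h
    exact hne h
  have hsurj : Function.Surjective Φ := by
    intro v
    refine ⟨∑ m : T, v m • ⟨_, orbit_mem m ((hT m).1 m.2).1⟩, ?_⟩
    ext m'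
    rw [hΦ]
    simp only [AddSubmonoidClass.coe_finsetSum, Submodule.coe_smul, coeff_sum, coeff_smul,
      coeff_monomial]
    rw [Finset.sum_eq_single m', Finset.sum_eq_single (0 : G)]
    · simp [shiftExp_zero]
    · intro γ _ hγ
      rw [if_neg]
      intro h
      have h2 := expSum_shiftExp' γ _ ((hT m').1 m'.2).1
      rw [h, ((hT m').1 m'.2).2, zero_add] at h2
      exact hγ h2.symm
    · simp
    · intro m _ hm
      rw [Finset.sum_eq_zero, smul_zero]
      intro γ _
      rw [if_neg]
      intro h
      have h2 := expSum_shiftExp' γ _ ((hT m).1 m.2).1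
      rw [h, ((hT m').1 m'.2).2, ((hT m).1 m.2).2, zero_add] at h2
      rw [← h2, shiftExp_zero] at h
      exact hm (Subtype.ext h)
    · simp
  rw [(LinearEquiv.ofBijective Φ ⟨hinj, hsurj⟩).finrank_eq]
  simp

/-- The number of monomials occurring (with nonzero coefficient) in the permanent of the
extended Cayley table of a finite abelian group `G` of order `n` (the `(n+1)×(n+1)`
addition table indexed by `I = G ⊕ {∗}` with `x(g) = g`, `x(∗) = 0`) equals the dimension
of the space of `G`-invariant homogeneous polynomials of degree `n+1` in
`ℂ[x_g : g ∈ G]`, where `G` acts by `γ · x_g = x_{g+γ}`. -/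
theorem card_extended_permanent_monomials_eq_finrank_invariants
    (G : Type*) [AddCommGroup G] [Fintype G] [DecidableEq G] :
    (∑ π : Equiv.Perm (G ⊕ Unit), ∏ i : G ⊕ Unit,
        (X (Sum.elim id (fun _ => (0 : G)) i + Sum.elim id (fun _ => (0 : G)) (π i)) :
          MvPolynomial G ℂ)).support.card =
    Module.finrank ℂ
      ↥(homogeneousSubmodule G ℂ (Fintype.card G + 1) ⊓
        ⨅ γ : G, LinearMap.eqLocus
          (rename (fun g => g + γ) : MvPolynomial G ℂ →ₐ[ℂ] MvPolynomial G ℂ).toLinearMap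
          LinearMap.id) := by
  exact (finrank_invSub _ mem_support_permanent).symm
end
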